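/- arXiv:1410.5086 — 2 statements merged into one kernel-verified Lean document; each statement's English description precedes it below -/
import Mathlib

section
/- Let (Ω,μ,T) be a weak mixing probability measure-preserving system that is, in addition, exact. Let α ∈ (0,1) be irrational, let I ⊆ [0,1) be a finite union of intervals, and let F, G ∈ L^∞(Ω,μ). Then for each t ∈ [0,1) there is a set Ω' ⊆ Ω of full μ-measure such that for all ω ∈ Ω': (1/N) ∑_{k=1}^N 𝟙_I({t+kα}) · F(T^{l_k(t)}ω) · G(T^k ω) → λ(I) · E_μ[F] · E_μ[G] as N → ∞. -/
open MeasureTheory Filter Topology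

/-- A probability measure-preserving system `(Ω, μ, T)` is weak mixing if the product
system `(Ω × Ω, μ × μ, T × T)` is ergodic. -/
def WeakMixing {Ω : Type*} [MeasurableSpace Ω] (T : Ω → Ω) (μ : Measure Ω) : Prop :=
  Ergodic (Prod.map T T) (μ.prod μ)

/-- A measure-preserving system is exact if every set belonging to `⋂ n, T⁻ⁿ(𝓑)`
has measure `0` or `1`. -/
def Exact {Ω : Type*} [MeasurableSpace Ω] (T : Ω → Ω) (μ : Measure Ω) : Prop :=
  ∀ A : Set Ω, (∀ n : ℕ, ∃ B : Set Ω, MeasurableSet B ∧ A = T^[n] ⁻¹' B) →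
    μ A = 0 ∨ μ A = 1

/-- `l_k(t) = ⌊t + α k⌋` (as a natural number). -/
noncomputable def lk (α t : ℝ) (k : ℕ) : ℕ := (⌊t + α * k⌋).toNat

/-- A finite union of (half-open) intervals in `ℝ`. -/
def IsFinUnionIntervals (I : Set ℝ) : Prop :=
  ∃ s : Finset (ℝ × ℝ), I = ⋃ p ∈ s, Set.Ico p.1 p.2

/-- The running maximum of `0` and the Birkhoff sums of `f` of length at most `N`. -/
noncomputable def birkhoffMax {Ω : Type*} (T : Ω → Ω) (f : Ω → ℝ) : ℕ → Ω → ℝ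
  | 0 => fun _ => 0
  | N + 1 => fun ω => max 0 (f ω + birkhoffMax T f N (T ω))

section BirkhoffMax

variable {Ω : Type*} {T : Ω → Ω} {f : Ω → ℝ}

lemma birkhoffMax_nonneg (N : ℕ) (ω : Ω) : 0 ≤ birkhoffMax T f N ω := by
  cases N with
  | zero => exact le_rfl
  | succ N => exact le_max_left _ _

lemma birkhoffMax_le_succ (N : ℕ) (ω : Ω) :
    birkhoffMax T f N ω ≤ birkhoffMax T f (N + 1) ω := by
  induction N generalizing ω with
  | zero => exact birkhoffMax_nonneg 1 ω
  | succ N ih => exact max_le_max le_rfl (by gcongr; exact ih _)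

lemma birkhoffSum_le_birkhoffMax (n : ℕ) (ω : Ω) :
    birkhoffSum T f n ω ≤ birkhoffMax T f n ω := by
  induction n generalizing ω with
  | zero => simp [birkhoffMax]
  | succ n ih =>
    rw [birkhoffSum_succ']
    exact (add_le_add_right (ih _) _).trans (le_max_right _ _)

variable [MeasurableSpace Ω] {μ : Measure Ω}

lemma measurable_birkhoffMax (hT : Measurable T) (hf : Measurable f) (N : ℕ) :
    Measurable (birkhoffMax T f N) := by
  induction N with
  | zero => exact measurable_const
  | succ N ih => exact measurable_const.max (hf.add (ih.comp hT))

lemma integrable_birkhoffMax [IsFiniteMeasure μ] (hT : MeasurePreserving T μ μ)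
    (hfi : Integrable f μ) (N : ℕ) : Integrable (birkhoffMax T f N) μ := by
  induction N with
  | zero => exact integrable_zero _ _ _
  | succ N ih =>
    exact (integrable_zero _ _ _).sup (hfi.add (hT.integrable_comp_of_integrable ih))

/-- The maximal ergodic theorem. -/
lemma setIntegral_birkhoffMax_pos_nonneg [IsFiniteMeasure μ] (hT : MeasurePreserving T μ μ)
    (hf : Measurable f) (hfi : Integrable f μ) (N : ℕ) :
    0 ≤ ∫ ω in {ω | 0 < birkhoffMax T f N ω}, f ω ∂μ := by
  cases N with
  | zero => simp [birkhoffMax]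
  | succ N =>
    have hE : MeasurableSet {ω | 0 < birkhoffMax T f (N + 1) ω} :=
      measurableSet_lt measurable_const (measurable_birkhoffMax hT.measurable hf _)
    have hi1 := integrable_birkhoffMax hT hfi (N + 1)
    have hi0 := integrable_birkhoffMax hT hfi N
    have hi0T := hT.integrable_comp_of_integrable hi0
    have hle : ∫ ω, (birkhoffMax T f (N + 1) ω - (birkhoffMax T f N ∘ T) ω) ∂μ ≤
        ∫ ω in {ω | 0 < birkhoffMax T f (N + 1) ω}, f ω ∂μ := by
      rw [← integral_indicator hE]
      refine integral_mono (hi1.sub hi0T) (hfi.indicator hE) fun ω => ?_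
      by_cases h : 0 < birkhoffMax T f (N + 1) ω
      · rw [Set.indicator_of_mem (by exact h)]
        have h' : birkhoffMax T f (N + 1) ω = max 0 (f ω + birkhoffMax T f N (T ω)) := rfl
        simp only [Function.comp]
        rcases max_choice 0 (f ω + birkhoffMax T f N (T ω)) with h2 | h2
        · rw [h'] at h; linarith
        · linarith
      · rw [Set.indicator_of_notMem (by exact h)]
        have := birkhoffMax_nonneg (T := T) (f := f) N (T ω)
        simp only [Function.comp]
        linarith
    refine le_trans ?_ hle
    rw [integral_sub hi1 hi0T, sub_nonneg]
    have : ∫ ω, (birkhoffMax T f N ∘ T) ω ∂μ = ∫ ω, birkhoffMax T f N ω ∂μ := by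
      conv_rhs => rw [← hT.map_eq]
      rw [integral_map hT.aemeasurable]
      · rfl
      · rw [hT.map_eq]; exact hi0.aestronglyMeasurable
    rw [this]
    exact integral_mono hi0 hi1 (birkhoffMax_le_succ N)

/-- The weak type `(1, 1)` maximal inequality for Birkhoff averages. -/
lemma measure_exists_lt_birkhoffSum_le [IsFiniteMeasure μ] (hT : MeasurePreserving T μ μ)
    (hf : Measurable f) (hfi : Integrable f μ) (hf0 : ∀ ω, 0 ≤ f ω) {ε : ℝ} (hε : 0 < ε) :
    μ {ω | ∃ n : ℕ, n * ε < birkhoffSum T f n ω} ≤ ENNReal.ofReal ((∫ ω, f ω ∂μ) / ε) := by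
  set g : Ω → ℝ := fun ω => f ω - ε
  have hg : Measurable g := hf.sub_const ε
  have hgi : Integrable g μ := hfi.sub (integrable_const ε)
  have hsum : ∀ n ω, birkhoffSum T g n ω = birkhoffSum T f n ω - n * ε := fun n ω => by
    simp [birkhoffSum, g, Finset.sum_sub_distrib]
  have hsub : {ω | ∃ n : ℕ, n * ε < birkhoffSum T f n ω} ⊆
      ⋃ N, {ω | 0 < birkhoffMax T g N ω} := by
    rintro ω ⟨n, hn⟩
    refine Set.mem_iUnion.2 ⟨n, lt_of_lt_of_le ?_ (birkhoffSum_le_birkhoffMax n ω)⟩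
    rw [hsum]; linarith
  have hmono : Monotone fun N => {ω | 0 < birkhoffMax T g N ω} :=
    monotone_nat_of_le_succ fun N ω h => lt_of_lt_of_le h (birkhoffMax_le_succ N ω)
  refine (measure_mono hsub).trans ?_
  rw [hmono.measure_iUnion]
  refine iSup_le fun N => ?_
  rw [← ofReal_measureReal]
  refine ENNReal.ofReal_le_ofReal ?_
  rw [le_div_iff₀ hε]
  have h := setIntegral_birkhoffMax_pos_nonneg hT hg hgi N
  rw [integral_sub hfi.integrableOn (integrable_const ε).integrableOn] at h
  have h2 := setIntegral_le_integral (s := {ω | 0 < birkhoffMax T g N ω}) hfi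
    (ae_of_all _ hf0)
  simp at h
  linarith

end BirkhoffMax

/-- The averages of a bounded real sequence tend to `0` as soon as they do so along squares. -/
lemma tendsto_average_of_tendsto_average_sq {x : ℕ → ℝ} {C : ℝ} (hx : ∀ k, |x k| ≤ C)
    (h : Tendsto (fun n : ℕ => (∑ k ∈ Finset.range (n ^ 2), x k) / ((n ^ 2 : ℕ) : ℝ))
      atTop (𝓝 0)) :
    Tendsto (fun N : ℕ => (∑ k ∈ Finset.range N, x k) / (N : ℝ)) atTop (𝓝 0) := by
  have key := tendsto_div_of_monotone_of_exists_subseq_tendsto_div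
    (fun N => ∑ k ∈ Finset.range N, (x k + C)) C
    (monotone_nat_of_le_succ fun N => by
      rw [Finset.sum_range_succ]
      linarith [neg_le_of_abs_le (hx N)])
    (fun a ha => ⟨fun n => n ^ 2, ?_, tendsto_pow_atTop two_ne_zero, ?_⟩)
  · have : Tendsto (fun N : ℕ => (∑ k ∈ Finset.range N, (x k + C)) / (N : ℝ) - C)
        atTop (𝓝 0) := by simpa using key.sub_const C
    refine this.congr' ?_
    filter_upwards [eventually_gt_atTop 0] with N hN
    have : (N : ℝ) ≠ 0 := by positivity
    rw [Finset.sum_add_distrib]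
    field_simp
    simp
  · have h1 : Tendsto (fun n : ℕ => ((1 : ℝ) + 1 / (n : ℝ)) ^ 2) atTop (𝓝 1) := by
      simpa using (tendsto_const_div_atTop_nhds_zero_nat (1 : ℝ)).const_add 1 |>.pow 2
    filter_upwards [h1.eventually (gt_mem_nhds ha), eventually_gt_atTop 0] with n hn hn0
    have hn' : (0 : ℝ) < n := by positivity
    push_cast
    have : ((n : ℝ) + 1) ^ 2 = (1 + 1 / (n : ℝ)) ^ 2 * n ^ 2 := by field_simp
    rw [this]
    gcongr
  · have : Tendsto (fun n : ℕ => (∑ k ∈ Finset.range (n ^ 2), x k) / ((n ^ 2 : ℕ) : ℝ) + C)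
        atTop (𝓝 C) := by simpa using h.add_const C
    refine this.congr' ?_
    filter_upwards [eventually_gt_atTop 0] with n hn
    have : (n : ℝ) ≠ 0 := by positivity
    rw [Finset.sum_add_distrib]
    push_cast
    field_simp
    simp

section Orthogonal

variable {Ω : Type*} [MeasurableSpace Ω] {μ : Measure Ω} [IsProbabilityMeasure μ]
  {X : ℕ → Ω → ℝ} {C : ℝ} {K p : ℕ}

lemma integral_sum_sq_le (hX : ∀ k, Measurable (X k)) (hXC : ∀ k ω, |X k ω| ≤ C)
    (horth : ∀ j k, K ≤ j → j + p ≤ k → ∫ ω, X j ω * X k ω ∂μ = 0) (N : ℕ) :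
    ∫ ω, (∑ k ∈ Finset.range N, X k ω) ^ 2 ∂μ ≤ N * ((2 * (K + p) + 1) * C ^ 2) := by
  have hi : ∀ j k, Integrable (fun ω => X j ω * X k ω) μ := fun j k =>
    Integrable.of_bound ((hX j).mul (hX k)).aestronglyMeasurable (C * C)
      (ae_of_all _ fun ω => by
        rw [Real.norm_eq_abs, abs_mul]
        exact mul_le_mul (hXC j ω) (hXC k ω) (abs_nonneg _) ((abs_nonneg _).trans (hXC j ω)))
  have hb : ∀ j k, |∫ ω, X j ω * X k ω ∂μ| ≤ C ^ 2 := fun j k => by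
    have := norm_integral_le_of_norm_le_const (μ := μ) (C := C * C)
      (f := fun ω => X j ω * X k ω) (ae_of_all _ fun ω => by
        rw [Real.norm_eq_abs, abs_mul]
        exact mul_le_mul (hXC j ω) (hXC k ω) (abs_nonneg _) ((abs_nonneg _).trans (hXC j ω)))
    simpa [sq] using this
  induction N with
  | zero => simp
  | succ N ih =>
    have e : ∀ ω, (∑ k ∈ Finset.range (N + 1), X k ω) ^ 2 =
        (∑ k ∈ Finset.range N, X k ω) ^ 2 + 2 * ∑ j ∈ Finset.range N, X j ω * X N ω
          + X N ω * X N ω := fun ω => by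
      rw [Finset.sum_range_succ, ← Finset.sum_mul]; ring
    have hsq : Integrable (fun ω => (∑ k ∈ Finset.range N, X k ω) ^ 2) μ := by
      simp only [sq, Finset.sum_mul_sum]
      exact integrable_finsetSum _ fun i _ => integrable_finsetSum _ fun j _ => hi i j
    have hcr : Integrable (fun ω => ∑ j ∈ Finset.range N, X j ω * X N ω) μ :=
      integrable_finsetSum _ fun i _ => hi i N
    have hsc : Integrable (fun ω => (∑ k ∈ Finset.range N, X k ω) ^ 2 +
        2 * ∑ j ∈ Finset.range N, X j ω * X N ω) μ := hsq.add (hcr.const_mul 2)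
    simp only [e]
    rw [integral_add hsc (hi N N), integral_add hsq (hcr.const_mul 2),
      integral_const_mul, integral_finsetSum _ fun i _ => hi i N]
    have hcross : ∑ j ∈ Finset.range N, ∫ ω, X j ω * X N ω ∂μ ≤ (K + p) * C ^ 2 := by
      have hsub : (Finset.range N).filter (fun j => j < K ∨ N < j + p) ⊆
          Finset.range K ∪ Finset.Ico (N - p) N := by
        intro j hj
        simp only [Finset.mem_filter, Finset.mem_range, Finset.mem_union, Finset.mem_Ico] at hj ⊢
        omega
      have hcard : (((Finset.range N).filter (fun j => j < K ∨ N < j + p)).card : ℝ) ≤ K + p := by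
        have := (Finset.card_le_card hsub).trans (Finset.card_union_le _ _)
        simp only [Finset.card_range, Nat.card_Ico] at this
        exact_mod_cast this.trans (by omega)
      calc ∑ j ∈ Finset.range N, ∫ ω, X j ω * X N ω ∂μ
          ≤ ∑ j ∈ Finset.range N, if j < K ∨ N < j + p then C ^ 2 else 0 := by
            refine Finset.sum_le_sum fun j _ => ?_
            split_ifs with h
            · exact (le_abs_self _).trans (hb j N)
            · push Not at h
              exact (horth j N h.1 h.2).le
        _ = ((Finset.range N).filter (fun j => j < K ∨ N < j + p)).card * C ^ 2 := by
            rw [← Finset.sum_filter, Finset.sum_const, nsmul_eq_mul]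
        _ ≤ (K + p) * C ^ 2 := by gcongr
    have hd := (le_abs_self _).trans (hb N N)
    push_cast
    linarith

/-- A strong law of large numbers for bounded, eventually `p`-step orthogonal sequences. -/
lemma ae_tendsto_average_of_orthogonal (hX : ∀ k, Measurable (X k)) (hXC : ∀ k ω, |X k ω| ≤ C)
    (horth : ∀ j k, K ≤ j → j + p ≤ k → ∫ ω, X j ω * X k ω ∂μ = 0) :
    ∀ᵐ ω ∂μ, Tendsto (fun N : ℕ => (∑ k ∈ Finset.range N, X k ω) / (N : ℝ)) atTop (𝓝 0) := by
  set D : ℝ := (2 * (K + p) + 1) * C ^ 2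
  set Y : ℕ → Ω → ℝ := fun n ω =>
    ((∑ k ∈ Finset.range (n ^ 2), X k ω) / ((n ^ 2 : ℕ) : ℝ)) ^ 2 with hY
  have hYm : ∀ n, Measurable (Y n) := fun n =>
    ((Finset.measurable_fun_sum _ fun k _ => hX k).div_const _).pow_const 2
  have hYb : ∀ n, ∫⁻ ω, ENNReal.ofReal (Y n ω) ∂μ ≤ ENNReal.ofReal (D * (1 / (n : ℝ) ^ 2)) := by
    intro n
    have hYi : Integrable (Y n) μ := by
      refine Integrable.of_bound (hYm n).aestronglyMeasurable (((n ^ 2 : ℕ) * C /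
        ((n ^ 2 : ℕ) : ℝ)) ^ 2) (ae_of_all _ fun ω => ?_)
      simp only [hY]
      rw [Real.norm_eq_abs, abs_pow, abs_div, Nat.abs_cast]
      gcongr
      refine (Finset.abs_sum_le_sum_abs _ _).trans ?_
      refine (Finset.sum_le_card_nsmul _ _ C fun k _ => hXC k ω).trans ?_
      simp
    rw [← ofReal_integral_eq_lintegral_ofReal hYi (ae_of_all _ fun ω => sq_nonneg _)]
    refine ENNReal.ofReal_le_ofReal ?_
    simp only [hY, div_pow]
    rw [integral_div]
    rcases Nat.eq_zero_or_pos n with rfl | hn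
    · simp
    have hn' : (0 : ℝ) < n := by positivity
    rw [div_le_iff₀ (by positivity)]
    refine (integral_sum_sq_le hX hXC horth (n ^ 2)).trans (le_of_eq ?_)
    push_cast
    field_simp
    simp [D]
  have hfin : ∫⁻ ω, ∑' n, ENNReal.ofReal (Y n ω) ∂μ ≠ ⊤ := by
    rw [lintegral_tsum fun n => (hYm n).ennreal_ofReal.aemeasurable]
    refine ne_top_of_le_ne_top ?_ (ENNReal.tsum_le_tsum hYb)
    have hs : Summable fun n : ℕ => D * (1 / (n : ℝ) ^ 2) :=
      (Real.summable_one_div_nat_pow.2 one_lt_two).mul_left D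
    exact hs.tsum_ofReal_ne_top
  have hae := ae_lt_top (Measurable.tsum fun n => (hYm n).ennreal_ofReal) hfin
  filter_upwards [hae] with ω hω
  refine tendsto_average_of_tendsto_average_sq (fun k => hXC k ω) ?_
  have h0 := ENNReal.tendsto_atTop_zero_of_tsum_ne_top hω.ne
  have h1 : Tendsto (fun n => Y n ω) atTop (𝓝 0) := by
    have := (ENNReal.tendsto_toReal ENNReal.zero_ne_top).comp h0
    refine this.congr fun n => ?_
    exact ENNReal.toReal_ofReal (sq_nonneg _)
  have h2 := h1.sqrt
  rw [Real.sqrt_zero] at h2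
  refine tendsto_zero_iff_abs_tendsto_zero _ |>.2 (h2.congr fun n => ?_)
  exact Real.sqrt_sq_eq_abs _

end Orthogonal

section Weyl

lemma fourier_coe_ne_one_of_irrational {α : ℝ} (hα : Irrational α) {n : ℤ} (hn : n ≠ 0) :
    (fourier n (α : UnitAddCircle) : ℂ) ≠ 1 := by
  intro h
  rw [fourier_apply, Circle.coe_eq_one, ← AddCircle.toCircle_zero (T := 1)] at h
  have h0 := AddCircle.injective_toCircle one_ne_zero h
  rw [← AddCircle.coe_zsmul, AddCircle.coe_eq_zero_iff] at h0
  obtain ⟨m, hm⟩ := h0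
  simp only [zsmul_eq_mul, mul_one] at hm
  exact (hα.intCast_mul hn).ne_int m hm.symm

lemma integral_fourier_eq_zero {n : ℤ} (hn : n ≠ 0) :
    ∫ y : UnitAddCircle, (fourier n y : ℂ) = 0 :=
  integral_eq_zero_of_add_right_eq_neg (fourier_add_half_inv_index hn one_pos)

lemma tendsto_average_fourier {α : ℝ} (hα : Irrational α) (x : UnitAddCircle) (n : ℤ) :
    Tendsto (fun N : ℕ => (N : ℂ)⁻¹ *
        ∑ k ∈ Finset.range N, (fourier n (x + k • (α : UnitAddCircle)) : ℂ))
      atTop (𝓝 (∫ y : UnitAddCircle, fourier n y)) := by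
  rcases eq_or_ne n 0 with rfl | hn
  · have : ∫ y : UnitAddCircle, (fourier 0 y : ℂ) = 1 := by
      simp [measureReal_def]
    rw [this]
    refine tendsto_const_nhds.congr' ?_
    filter_upwards [eventually_gt_atTop 0] with N hN
    have : (N : ℂ) ≠ 0 := by exact_mod_cast hN.ne'
    simp [this]
  · rw [integral_fourier_eq_zero hn]
    set z : ℂ := fourier n (α : UnitAddCircle) with hz
    have hz1 : z ≠ 1 := fourier_coe_ne_one_of_irrational hα hn
    have hzn : ‖z‖ = 1 := Circle.norm_coe _
    have hterm : ∀ k : ℕ, (fourier n (x + k • (α : UnitAddCircle)) : ℂ) = fourier n x * z ^ k := by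
      intro k
      simp only [hz, fourier_apply]
      rw [smul_add, smul_comm, AddCircle.toCircle_add, AddCircle.toCircle_nsmul]
      push_cast
      rfl
    have hb : ∀ N : ℕ, ‖∑ k ∈ Finset.range N, (fourier n (x + k • (α : UnitAddCircle)) : ℂ)‖ ≤
        2 / ‖z - 1‖ := by
      intro N
      simp_rw [hterm]
      rw [← Finset.mul_sum, geom_sum_eq hz1, norm_mul, norm_div]
      have h1 : ‖(fourier n x : ℂ)‖ = 1 := Circle.norm_coe _
      rw [h1, one_mul]
      gcongr
      refine (norm_sub_le _ _).trans ?_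
      rw [norm_pow, hzn]
      norm_num
    have hlim : Tendsto (fun N : ℕ => (N : ℝ)⁻¹ * (2 / ‖z - 1‖)) atTop (𝓝 0) := by
      simpa using (tendsto_inv_atTop_nhds_zero_nat (𝕜 := ℝ)).mul_const (2 / ‖z - 1‖)
    refine squeeze_zero_norm (fun N => ?_) hlim
    rw [norm_mul, norm_inv, Complex.norm_natCast]
    gcongr
    exact hb N

/-- Weyl's equidistribution theorem for continuous functions. -/
lemma tendsto_average_irrational_rotation {α : ℝ} (hα : Irrational α) (x : UnitAddCircle)
    (f : C(UnitAddCircle, ℂ)) :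
    Tendsto (fun N : ℕ => (N : ℂ)⁻¹ *
        ∑ k ∈ Finset.range N, f (x + k • (α : UnitAddCircle)))
      atTop (𝓝 (∫ y : UnitAddCircle, f y)) := by
  have : IsProbabilityMeasure (volume : Measure UnitAddCircle) := ⟨UnitAddCircle.measure_univ⟩
  have hint : ∀ g : C(UnitAddCircle, ℂ), Integrable (fun y => g y) volume := fun g =>
    g.continuous.integrable_of_hasCompactSupport
      (HasCompactSupport.of_compactSpace _)
  have hspan : ∀ g ∈ Submodule.span ℂ (Set.range (fourier (T := 1))),
      Tendsto (fun N : ℕ => (N : ℂ)⁻¹ *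
        ∑ k ∈ Finset.range N, g (x + k • (α : UnitAddCircle)))
      atTop (𝓝 (∫ y : UnitAddCircle, g y)) := by
    intro g hg
    induction hg using Submodule.span_induction with
    | mem g hg =>
      obtain ⟨n, rfl⟩ := hg
      exact tendsto_average_fourier hα x n
    | zero => simp
    | add g h _ _ hg hh =>
      have := hg.add hh
      rw [← integral_add (hint g) (hint h)] at this
      refine this.congr fun N => ?_
      simp [Finset.sum_add_distrib, mul_add]
    | smul c g _ hg =>
      have := hg.const_mul c
      rw [← integral_const_mul] at this
      refine this.congr fun N => ?_
      simp only [ContinuousMap.smul_apply, smul_eq_mul, ← Finset.mul_sum]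
      ring
  rw [Metric.tendsto_atTop]
  intro ε hε
  have hmem : f ∈ closure (Submodule.span ℂ (Set.range (fourier (T := 1))) :
      Set C(UnitAddCircle, ℂ)) := by
    rw [← Submodule.topologicalClosure_coe, span_fourier_closure_eq_top]
    trivial
  obtain ⟨g, hg, hfg⟩ := Metric.mem_closure_iff.1 hmem (ε / 3) (by positivity)
  obtain ⟨N₀, hN₀⟩ := Metric.tendsto_atTop.1 (hspan g hg) (ε / 3) (by positivity)
  refine ⟨N₀, fun N hN => ?_⟩
  have hpt : ∀ y, ‖f y - g y‖ ≤ ε / 3 := fun y => by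
    rw [← dist_eq_norm]
    exact (ContinuousMap.dist_apply_le_dist y).trans hfg.le
  have h1 : dist ((N : ℂ)⁻¹ * ∑ k ∈ Finset.range N, f (x + k • (α : UnitAddCircle)))
      ((N : ℂ)⁻¹ * ∑ k ∈ Finset.range N, g (x + k • (α : UnitAddCircle))) ≤ ε / 3 := by
    rw [dist_eq_norm, ← mul_sub, ← Finset.sum_sub_distrib, norm_mul, norm_inv,
      Complex.norm_natCast]
    rcases Nat.eq_zero_or_pos N with rfl | hN0
    · simp; positivity
    rw [inv_mul_le_iff₀ (by positivity)]
    refine (norm_sum_le _ _).trans ((Finset.sum_le_card_nsmul _ _ _ fun k _ => hpt _).trans ?_)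
    simp
  have h2 : dist (∫ y : UnitAddCircle, g y) (∫ y : UnitAddCircle, f y) ≤ ε / 3 := by
    rw [dist_comm, dist_eq_norm, ← integral_sub (hint f) (hint g)]
    simpa using norm_integral_le_of_norm_le_const (μ := (volume : Measure UnitAddCircle))
      (ae_of_all _ hpt)
  have h3 := hN₀ N hN
  linarith [dist_triangle4 ((N : ℂ)⁻¹ * ∑ k ∈ Finset.range N, f (x + k • (α : UnitAddCircle)))
      ((N : ℂ)⁻¹ * ∑ k ∈ Finset.range N, g (x + k • (α : UnitAddCircle)))
      (∫ y : UnitAddCircle, g y) (∫ y : UnitAddCircle, f y)]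

/-- The empirical measure of the first `N + 1` terms of a sequence. -/
noncomputable def empiricalMeasure {X : Type*} [MeasurableSpace X] (u : ℕ → X) (N : ℕ) :
    Measure X :=
  ((N + 1 : ℕ) : ENNReal)⁻¹ • ∑ k ∈ Finset.range (N + 1), Measure.dirac (u k)

instance {X : Type*} [MeasurableSpace X] (u : ℕ → X) (N : ℕ) :
    IsProbabilityMeasure (empiricalMeasure u N) where
  measure_univ := by
    simp only [empiricalMeasure, Measure.smul_apply, Measure.finsetSum_apply, measure_univ,
      Finset.sum_const, Finset.card_range, smul_eq_mul, nsmul_eq_mul, mul_one]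
    exact ENNReal.inv_mul_cancel (by simp) (ENNReal.natCast_ne_top _)

/-- Weyl's equidistribution theorem for sets with negligible boundary. -/
lemma tendsto_average_indicator_irrational_rotation {α : ℝ} (hα : Irrational α)
    (x : UnitAddCircle) {E : Set UnitAddCircle} (hEm : MeasurableSet E)
    (hE : volume (frontier E) = 0) :
    Tendsto (fun N : ℕ => (N : ℝ)⁻¹ *
        ∑ k ∈ Finset.range N, E.indicator (1 : UnitAddCircle → ℝ) (x + k • (α : UnitAddCircle)))
      atTop (𝓝 (volume.real E)) := by
  have : IsProbabilityMeasure (volume : Measure UnitAddCircle) := ⟨UnitAddCircle.measure_univ⟩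
  set u : ℕ → UnitAddCircle := fun k => x + k • (α : UnitAddCircle)
  set ν : ProbabilityMeasure UnitAddCircle := ⟨volume, inferInstance⟩
  set νs : ℕ → ProbabilityMeasure UnitAddCircle := fun N => ⟨empiricalMeasure u N, inferInstance⟩
  have hlim : Tendsto νs atTop (𝓝 ν) := by
    rw [ProbabilityMeasure.tendsto_iff_forall_integral_rclike_tendsto ℂ]
    intro f
    have := (tendsto_average_irrational_rotation hα x f.toContinuousMap).comp
      (tendsto_add_atTop_nat 1)
    refine this.congr fun N => ?_
    simp only [νs, empiricalMeasure, ProbabilityMeasure.coe_mk, Function.comp]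
    rw [integral_smul_measure, integral_finsetSum_measure fun k _ => integrable_dirac (by simp),
      ENNReal.toReal_inv, ENNReal.toReal_natCast]
    simp [u]
  have h := ProbabilityMeasure.tendsto_measure_of_null_frontier_of_tendsto' hlim (E := E) hE
  have h' := (ENNReal.tendsto_toReal (measure_ne_top _ _)).comp h
  refine (tendsto_add_atTop_iff_nat 1).1 (h'.congr fun N => ?_)
  simp only [νs, empiricalMeasure, ProbabilityMeasure.coe_mk, Function.comp, Measure.smul_apply,
    Measure.finsetSum_apply, smul_eq_mul, Measure.dirac_apply' _ hEm, ENNReal.toReal_mul,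
    ENNReal.toReal_inv, ENNReal.toReal_natCast]
  rw [ENNReal.toReal_sum]
  · congr 1
    refine Finset.sum_congr rfl fun k _ => ?_
    change (E.indicator 1 (u k) : ENNReal).toReal = E.indicator 1 (u k)
    by_cases hk : u k ∈ E <;> simp [hk]
  · intro k _
    by_cases hk : u k ∈ E <;> simp [hk]

lemma UnitAddCircle.volume_singleton (x : UnitAddCircle) : volume {x} = 0 := by
  have := AddCircle.volume_closedBall (T := 1) (x := x) 0
  simpa using this

lemma frontier_coe_image_Ico_subset (a b : ℝ) :
    frontier ((↑) '' Set.Ico a b : Set UnitAddCircle) ⊆ {(a : UnitAddCircle), (b : UnitAddCircle)} := by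
  have hcl : closure ((↑) '' Set.Ico a b : Set UnitAddCircle) ⊆ (↑) '' Set.Icc a b :=
    closure_minimal (Set.image_mono Set.Ico_subset_Icc_self)
      (isCompact_Icc.image (AddCircle.continuous_mk' 1)).isClosed
  have hin : ((↑) '' Set.Ioo a b : Set UnitAddCircle) ⊆
      interior ((↑) '' Set.Ico a b : Set UnitAddCircle) :=
    interior_maximal (Set.image_mono Set.Ioo_subset_Ico_self)
      (QuotientAddGroup.isOpenMap_coe _ isOpen_Ioo)
  rintro y ⟨hy, hy'⟩
  obtain ⟨r, hr, rfl⟩ := hcl hy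
  rcases eq_or_lt_of_le hr.1 with rfl | h1
  · exact Or.inl rfl
  rcases eq_or_lt_of_le hr.2 with rfl | h2
  · exact Or.inr rfl
  exact absurd (hin ⟨r, ⟨h1, h2⟩, rfl⟩) hy'

lemma volume_frontier_biUnion_eq_zero {X ι : Type*} [TopologicalSpace X] [MeasureSpace X]
    (s : Finset ι) (A : ι → Set X) (h : ∀ i ∈ s, volume (frontier (A i)) = 0) :
    volume (frontier (⋃ i ∈ s, A i)) = 0 := by
  have hsub : frontier (⋃ i ∈ s, A i) ⊆ ⋃ i ∈ s, frontier (A i) := by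
    rintro y ⟨hy, hy'⟩
    rw [s.closure_biUnion] at hy
    simp only [Set.mem_iUnion] at hy ⊢
    obtain ⟨i, hi, hyi⟩ := hy
    exact ⟨i, hi, hyi, fun h => hy' (interior_mono (Set.subset_biUnion_of_mem hi) h)⟩
  exact measure_mono_null hsub ((measure_biUnion_null_iff s.countable_toSet).2 h)

lemma coe_mem_coe_image_iff {I : Set ℝ} (hI : I ⊆ Set.Ico 0 1) (x : ℝ) :
    (x : UnitAddCircle) ∈ ((↑) '' I : Set UnitAddCircle) ↔ Int.fract x ∈ I := by
  constructor
  · rintro ⟨y, hy, hxy⟩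
    obtain ⟨n, hn⟩ := (QuotientAddGroup.eq_iff_sub_mem.1 hxy)
    have : x = y - n := by simp at hn; linarith
    rw [this, Int.fract_sub_intCast, Int.fract_eq_self.2 (hI hy)]
    exact hy
  · intro h
    refine ⟨_, h, QuotientAddGroup.eq_iff_sub_mem.2 ⟨-⌊x⌋, ?_⟩⟩
    simp only [zsmul_eq_mul, mul_one, Int.cast_neg]
    linarith [Int.self_sub_floor x]

/-- Weyl's equidistribution theorem for finite unions of intervals. -/
lemma tendsto_average_indicator_fract {α : ℝ} (hα : Irrational α) (x : ℝ)
    (s : Finset (ℝ × ℝ)) (hI01 : (⋃ p ∈ s, Set.Ico p.1 p.2) ⊆ Set.Ico (0 : ℝ) 1) :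
    Tendsto (fun N : ℕ => (N : ℝ)⁻¹ *
        ∑ k ∈ Finset.range N,
          (⋃ p ∈ s, Set.Ico p.1 p.2).indicator (1 : ℝ → ℝ) (Int.fract (x + k * α)))
      atTop (𝓝 (volume.real (⋃ p ∈ s, Set.Ico p.1 p.2))) := by
  set I : Set ℝ := ⋃ p ∈ s, Set.Ico p.1 p.2 with hI
  set E : Set UnitAddCircle := (↑) '' I with hE
  have hIm : MeasurableSet I := s.measurableSet_biUnion fun p _ => measurableSet_Ico
  have hEI : (↑) ⁻¹' E ∩ Set.Ico (0 : ℝ) 1 = I := by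
    ext y
    simp only [Set.mem_inter_iff, Set.mem_preimage]
    rw [hE, coe_mem_coe_image_iff hI01]
    constructor
    · rintro ⟨h, hy⟩
      rwa [Int.fract_eq_self.2 hy] at h
    · intro h
      rw [Int.fract_eq_self.2 (hI01 h)]
      exact ⟨h, hI01 h⟩
  have hEm : MeasurableSet E := by
    have : E = (fun y => ((AddCircle.measurableEquivIco 1 0 y : Set.Ico (0 : ℝ) (0 + 1)) : ℝ)) ⁻¹' I := by
      ext y
      induction y using QuotientAddGroup.induction_on with
      | H y =>
        rw [hE]
        refine (coe_mem_coe_image_iff hI01 y).trans ?_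
        simp only [Set.mem_preimage]
        have : ((AddCircle.measurableEquivIco 1 0 (y : UnitAddCircle) :
            Set.Ico (0 : ℝ) (0 + 1)) : ℝ) = Int.fract y :=
          AddCircle.coe_equivIco_mk_apply 1 y |>.trans (by simp)
        rw [← this]
    rw [this]
    exact (measurable_subtype_coe.comp (AddCircle.measurableEquivIco 1 0).measurable) hIm
  have hvol : volume.real E = volume.real I := by
    rw [measureReal_def, measureReal_def, AddCircle.add_projection_respects_measure 1 0 hEm,
      ← hEI]
    congr 1
    refine measure_congr ((ae_eq_refl _).inter ?_)
    simpa using (Ico_ae_eq_Ioc (μ := (volume : Measure ℝ)) (a := 0) (b := 1)).symm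
  have hfr : volume (frontier E) = 0 := by
    have : E = ⋃ p ∈ s, ((↑) '' Set.Ico p.1 p.2 : Set UnitAddCircle) := by
      simp only [hE, hI, Set.image_iUnion]
    rw [this]
    refine volume_frontier_biUnion_eq_zero _ _ fun p _ => ?_
    refine measure_mono_null (frontier_coe_image_Ico_subset _ _) ?_
    rw [Set.insert_eq]
    exact measure_union_null (UnitAddCircle.volume_singleton _) (UnitAddCircle.volume_singleton _)
  have key := tendsto_average_indicator_irrational_rotation hα (x : UnitAddCircle) hEm hfr
  rw [hvol] at key
  refine key.congr fun N => ?_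
  congr 1
  refine Finset.sum_congr rfl fun k _ => ?_
  have hc : (x : UnitAddCircle) + k • (α : UnitAddCircle) = ((x + k * α : ℝ) : UnitAddCircle) := by
    simp
  have hiff := coe_mem_coe_image_iff hI01 (x + k * α)
  rw [hc]
  by_cases h : Int.fract (x + k * α) ∈ I
  · rw [Set.indicator_of_mem h, Set.indicator_of_mem (hiff.2 h)]; rfl
  · rw [Set.indicator_of_notMem h, Set.indicator_of_notMem (mt hiff.1 h)]

end Weyl

section Exactness

variable {Ω : Type*} [mΩ : MeasurableSpace Ω] {T : Ω → Ω} {μ : Measure Ω}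

lemma comap_iterate_antitone (hT : Measurable T) :
    Antitone fun n : ℕ => mΩ.comap T^[n] := by
  intro n k hnk
  obtain ⟨d, rfl⟩ := Nat.exists_eq_add_of_le' hnk
  simp only
  rw [Function.iterate_add, ← MeasurableSpace.comap_comp]
  exact MeasurableSpace.comap_mono (hT.iterate d).comap_le

/-- A function that is a.e. measurable with respect to every `T⁻ⁿ(𝓑)` is a.e. constant when the
system is exact. -/
lemma Exact.ae_eq_const [IsProbabilityMeasure μ] (hexact : Exact T μ) (hT : Measurable T)
    {f : Ω → ℝ} (hf : ∀ n : ℕ, AEStronglyMeasurable[mΩ.comap T^[n]] f μ) :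
    ∃ c : ℝ, f =ᵐ[μ] fun _ => c := by
  set g : ℕ → Ω → ℝ := fun n => (hf n).mk f
  have hg : ∀ n, StronglyMeasurable[mΩ.comap T^[n]] (g n) := fun n => (hf n).stronglyMeasurable_mk
  have hfg : ∀ᵐ ω ∂μ, ∀ n, f ω = g n ω := ae_all_iff.2 fun n => (hf n).ae_eq_mk
  set h : Ω → ℝ := fun ω => limsup (fun n => g n ω) atTop with hh
  have hfh : f =ᵐ[μ] h := by
    filter_upwards [hfg] with ω hω
    simp [hh, ← hω]
  have hhm : ∀ N, Measurable[mΩ.comap T^[N]] h := by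
    intro N
    have e : h = fun ω => limsup (fun n => g (n + N) ω) atTop := by
      funext ω
      exact (limsup_nat_add (fun n => g n ω) N).symm
    rw [e]
    exact Measurable.limsup fun n => (hg (n + N)).measurable.mono
      (comap_iterate_antitone hT (Nat.le_add_left N n)) le_rfl
  have hm0 : Measurable h := (hhm 0).mono (hT.iterate 0).comap_le le_rfl
  obtain ⟨c, hc⟩ := exists_eventuallyEq_const_of_forall_separating (l := ae μ) (f := h)
    MeasurableSet fun U hU => by
      have hA : MeasurableSet (h ⁻¹' U) := hm0 hU
      rcases hexact (h ⁻¹' U) fun n => by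
        obtain ⟨B, hB, hBe⟩ := hhm n hU
        exact ⟨B, hB, hBe.symm⟩ with h0 | h1
      · exact Or.inr (measure_eq_zero_iff_ae_notMem.1 h0)
      · exact Or.inl ((prob_compl_eq_zero_iff hA).2 h1)
  exact ⟨c, hfh.trans hc⟩

lemma integral_abs_le_norm_Lp_two [IsProbabilityMeasure μ] (h : Lp ℝ 2 μ) :
    ∫ ω, |h ω| ∂μ ≤ ‖h‖ := by
  have h1 : ∫ ω, |h ω| ∂μ = (eLpNorm h 1 μ).toReal := by
    rw [eLpNorm_one_eq_lintegral_enorm, ← integral_norm_eq_lintegral_enorm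
      (Lp.aestronglyMeasurable h)]
    rfl
  rw [h1, Lp.norm_def]
  exact ENNReal.toReal_mono (Lp.eLpNorm_ne_top h)
    (eLpNorm_le_eLpNorm_of_exponent_le one_le_two (Lp.aestronglyMeasurable h))

/-- In an exact system the conditional expectations of a centred bounded function with respect
to `T⁻ⁿ(𝓑)` tend to `0` in `L¹`. -/
lemma Exact.tendsto_integral_abs_condExp [IsProbabilityMeasure μ] (hexact : Exact T μ)
    (hT : Measurable T) {F : Ω → ℝ} (hF : MemLp F 2 μ) (hF0 : ∫ ω, F ω ∂μ = 0) :
    Tendsto (fun n : ℕ => ∫ ω, |(μ[F | mΩ.comap T^[n]]) ω| ∂μ) atTop (𝓝 0) := by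
  have hle : ∀ n : ℕ, mΩ.comap T^[n] ≤ mΩ := fun n => (hT.iterate n).comap_le
  have hfact : ∀ n : ℕ, Fact (mΩ.comap T^[n] ≤ mΩ) := fun n => ⟨hle n⟩
  set K : ℕ → Submodule ℝ (Lp ℝ 2 μ) := fun n => lpMeas ℝ ℝ (mΩ.comap T^[n]) 2 μ with hK
  have hKp : ∀ n, (K n).HasOrthogonalProjection := fun n => by
    have := hfact n
    simp only [hK]
    infer_instance
  have hmono : Monotone fun n => (K n)ᗮ := fun n k hnk =>
    Submodule.orthogonal_le fun f hf => by
      rw [mem_lpMeas_iff_aestronglyMeasurable] at hf ⊢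
      exact hf.mono (comap_iterate_antitone hT hnk)
  set f : Lp ℝ 2 μ := hF.toLp with hf
  have hlim := Submodule.starProjection_tendsto_closure_iSup _ hmono f
  set g : Lp ℝ 2 μ := f - (⨆ n, (K n)ᗮ).topologicalClosure.starProjection f with hg
  have hP : Tendsto (fun n => (K n).starProjection f) atTop (𝓝 g) := by
    refine (hlim.const_sub f).congr fun n => ?_
    rw [Submodule.starProjection_orthogonal_val]
    simp
  have hgK : ∀ n, g ∈ K n := fun n => by
    have h1 : g ∈ ((⨆ n, (K n)ᗮ).topologicalClosure)ᗮ :=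
      Submodule.sub_starProjection_mem_orthogonal f
    have h2 : g ∈ (K n)ᗮᗮ := Submodule.orthogonal_le
      ((le_iSup (fun n => (K n)ᗮ) n).trans (Submodule.le_topologicalClosure _)) h1
    rwa [Submodule.orthogonal_orthogonal] at h2
  have hae : ∀ n, ((K n).starProjection f : Lp ℝ 2 μ) =ᵐ[μ] μ[F | mΩ.comap T^[n]] := fun n =>
    hF.condExpL2_ae_eq_condExp (𝕜 := ℝ) (hle n)
  obtain ⟨c, hc⟩ := hexact.ae_eq_const hT fun n => mem_lpMeas_iff_aestronglyMeasurable.1 (hgK n)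
  have hPint : ∀ n, ∫ ω, ((K n).starProjection f : Lp ℝ 2 μ) ω ∂μ = 0 := fun n => by
    rw [integral_congr_ae (hae n), integral_condExp (hle n), hF0]
  have hLi : ∀ h : Lp ℝ 2 μ, Integrable h μ := fun h => (Lp.memLp h).integrable one_le_two
  have hgc : ∫ ω, g ω ∂μ = c := by rw [integral_congr_ae hc]; simp
  have hnorm : Tendsto (fun n => ‖(K n).starProjection f - g‖) atTop (𝓝 0) :=
    tendsto_iff_norm_sub_tendsto_zero.1 hP
  have hc0 : c = 0 := by
    have hb : ∀ n, |c| ≤ ‖(K n).starProjection f - g‖ := fun n => by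
      have e : ∫ ω, ((K n).starProjection f - g : Lp ℝ 2 μ) ω ∂μ = -c := by
        rw [integral_congr_ae (Lp.coeFn_sub _ _)]
        simp only [Pi.sub_apply]
        rw [integral_sub (hLi _) (hLi _), hPint, hgc, zero_sub]
      rw [← abs_neg, ← e]
      exact (abs_integral_le_integral_abs).trans (integral_abs_le_norm_Lp_two _)
    exact abs_nonpos_iff.1 (ge_of_tendsto' hnorm hb)
  have hg0 : g = 0 := by
    refine Lp.ext ((hc.trans ?_).trans (Lp.coeFn_zero _ _ _).symm)
    rw [hc0]; rfl
  simp only [hg0, sub_zero] at hnorm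
  refine squeeze_zero (fun n => integral_nonneg fun ω => abs_nonneg _) (fun n => ?_) hnorm
  have e : ∫ ω, |((K n).starProjection f : Lp ℝ 2 μ) ω| ∂μ =
      ∫ ω, |(μ[F | mΩ.comap T^[n]]) ω| ∂μ := integral_congr_ae ((hae n).fun_comp abs)
  exact e.symm.le.trans (integral_abs_le_norm_Lp_two _)

/-- In an exact system, a centred bounded function can be approximated in `L¹` by functions
orthogonal to every `V ∘ T^[n]`, for a suitable `n`. -/
lemma Exact.exists_small_of_centred [IsProbabilityMeasure μ] (hexact : Exact T μ)
    (hT : Measurable T) {F : Ω → ℝ} (hFm : Measurable F) {C : ℝ} (hFC : ∀ ω, |F ω| ≤ C)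
    (hF0 : ∫ ω, F ω ∂μ = 0) {ε : ℝ} (hε : 0 < ε) :
    ∃ n : ℕ, ∃ Φ : Ω → ℝ, Measurable Φ ∧ (∀ ω, |Φ ω| ≤ C) ∧ ∫ ω, |Φ ω| ∂μ < ε ∧
      ∀ V : Ω → ℝ, Measurable V → (∃ B, ∀ ω, |V (T^[n] ω)| ≤ B) →
        ∫ ω, V (T^[n] ω) * (F ω - Φ ω) ∂μ = 0 := by
  have hF : MemLp F 2 μ := MemLp.of_bound hFm.aestronglyMeasurable C (ae_of_all _ hFC)
  have hFi : Integrable F μ := hF.integrable one_le_two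
  obtain ⟨n, hn⟩ := ((hexact.tendsto_integral_abs_condExp hT hF hF0).eventually
    (gt_mem_nhds hε)).exists
  have hle : mΩ.comap T^[n] ≤ mΩ := (hT.iterate n).comap_le
  obtain ⟨ω₀⟩ : Nonempty Ω := μ.nonempty_of_neZero
  have hC : 0 ≤ C := (abs_nonneg _).trans (hFC ω₀)
  set E : Ω → ℝ := μ[F | mΩ.comap T^[n]] with hE
  have hEm : Measurable E := stronglyMeasurable_condExp.measurable.mono hle le_rfl
  set Φ : Ω → ℝ := fun ω => max (-C) (min C (E ω)) with hΦ
  have hΦm : Measurable Φ := measurable_const.max (measurable_const.min hEm)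
  have hΦC : ∀ ω, |Φ ω| ≤ C := fun ω =>
    abs_le.2 ⟨le_max_left _ _, max_le (by linarith) (min_le_left _ _)⟩
  have hΦE : Φ =ᵐ[μ] E := by
    filter_upwards [ae_bdd_abs_condExp_of_ae_bdd_abs (m := mΩ.comap T^[n]) (μ := μ)
      (ae_of_all _ hFC)] with ω hω
    have h2 := abs_le.1 hω
    simp only [hΦ]
    rw [min_eq_right h2.2, max_eq_right h2.1]
  have hΦi : Integrable Φ μ := Integrable.of_bound hΦm.aestronglyMeasurable C (ae_of_all _ hΦC)
  refine ⟨n, Φ, hΦm, hΦC, ?_, ?_⟩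
  · have e : ∫ ω, |Φ ω| ∂μ = ∫ ω, |E ω| ∂μ := integral_congr_ae (hΦE.fun_comp abs)
    rwa [e]
  · rintro V hV ⟨B, hB⟩
    have hVm : Measurable[mΩ.comap T^[n]] (fun ω => V (T^[n] ω)) :=
      hV.comp (comap_measurable _)
    have hVm' : Measurable (fun ω => V (T^[n] ω)) := hVm.mono hle le_rfl
    have hVF : Integrable (fun ω => V (T^[n] ω) * F ω) μ :=
      hFi.bdd_mul hVm'.aestronglyMeasurable (ae_of_all _ hB)
    have hVΦ : Integrable (fun ω => V (T^[n] ω) * Φ ω) μ :=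
      hΦi.bdd_mul hVm'.aestronglyMeasurable (ae_of_all _ hB)
    simp only [mul_sub]
    rw [integral_sub hVF hVΦ, sub_eq_zero, ← integral_condExp hle (f := fun ω => V (T^[n] ω) * F ω)]
    refine integral_congr_ae ?_
    have hpull := condExp_mul_of_stronglyMeasurable_left (μ := μ) hVm.stronglyMeasurable hVF hFi
    refine hpull.trans ?_
    filter_upwards [hΦE] with ω hω
    simp only [Pi.mul_apply, hω, hE]

end Exactness

/-- Almost everywhere convergence to `0` follows from eventual smallness off sets of arbitrarily
small measure. -/
lemma ae_tendsto_zero_of_forall_exists_measure_le {Ω : Type*} [MeasurableSpace Ω] {μ : Measure Ω}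
    {Y : ℕ → Ω → ℝ}
    (h : ∀ ε > 0, ∀ η > 0, ∃ S : Set Ω, μ S ≤ ENNReal.ofReal η ∧
      ∀ᵐ ω ∂μ, ω ∉ S → ∀ᶠ N in atTop, |Y N ω| ≤ ε) :
    ∀ᵐ ω ∂μ, Tendsto (fun N => Y N ω) atTop (𝓝 0) := by
  have key : ∀ ε > 0, ∀ᵐ ω ∂μ, ∀ᶠ N in atTop, |Y N ω| ≤ ε := fun ε hε => by
    have hle : ∀ η > 0, μ {ω | ¬ ∀ᶠ N in atTop, |Y N ω| ≤ ε} ≤ ENNReal.ofReal η := fun η hη => by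
      obtain ⟨S, hS, hae⟩ := h ε hε η hη
      refine (measure_mono_ae ?_).trans hS
      filter_upwards [hae] with ω hω hbad
      by_contra hωS
      exact hbad (hω hωS)
    refine ae_iff.2 (le_antisymm (ENNReal.le_of_forall_pos_le_add fun η hη _ => ?_) zero_le)
    simpa using hle η hη
  have hall : ∀ᵐ ω ∂μ, ∀ j : ℕ, ∀ᶠ N in atTop, |Y N ω| ≤ 1 / ((j : ℝ) + 1) :=
    ae_all_iff.2 fun j => key _ (by positivity)
  filter_upwards [hall] with ω hω
  refine Metric.tendsto_nhds.2 fun ε hε => ?_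
  obtain ⟨j, hj⟩ := exists_nat_one_div_lt hε
  filter_upwards [hω j] with N hN
  simpa using hN.trans_lt hj

lemma sum_comp_le_mul_sum_range {a : ℕ → ℕ} (ha : Monotone a) (hak : ∀ k, a k ≤ k + 1) {m : ℕ}
    (ham : ∀ k, a k + 1 ≤ a (k + m)) {f : ℕ → ℝ} (hf : ∀ i, 0 ≤ f i) (N : ℕ) :
    ∑ k ∈ Finset.range N, f (a k) ≤ m * ∑ i ∈ Finset.range (N + 1), f i := by
  rw [Finset.sum_comp, Finset.mul_sum]
  have hcard : ∀ b, ((Finset.range N).filter fun k => a k = b).card ≤ m := fun b => by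
    rcases ((Finset.range N).filter fun k => a k = b).eq_empty_or_nonempty with he | hne
    · simp [he]
    · obtain ⟨k₀, hk₀, hmin⟩ := Finset.exists_min_image _ id hne
      have hsub : ((Finset.range N).filter fun k => a k = b) ⊆ Finset.Ico k₀ (k₀ + m) := by
        intro k hk
        refine Finset.mem_Ico.2 ⟨hmin k hk, ?_⟩
        by_contra! hlt
        have h1 := ham k₀
        have h2 := ha hlt
        rw [(Finset.mem_filter.1 hk).2] at h2
        rw [(Finset.mem_filter.1 hk₀).2] at h1
        omega
      simpa using Finset.card_le_card hsub
  refine (Finset.sum_le_sum fun b _ => ?_).trans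
    (Finset.sum_le_sum_of_subset_of_nonneg (fun b hb => ?_) fun i _ _ =>
      mul_nonneg (Nat.cast_nonneg m) (hf i))
  · rw [nsmul_eq_mul]
    exact mul_le_mul_of_nonneg_right (Nat.cast_le.2 (hcard b)) (hf b)
  · obtain ⟨k, hk, rfl⟩ := Finset.mem_image.1 hb
    have := hak k
    simp only [Finset.mem_range] at hk ⊢
    omega

section WeightedAverage

variable {Ω : Type*} [MeasurableSpace Ω] {T : Ω → Ω} {μ : Measure Ω} {a : ℕ → ℕ} {m : ℕ}

lemma MeasureTheory.MeasurePreserving.integral_mul_comp_iterate_eq_zero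
    (hT : MeasurePreserving T μ μ) {n : ℕ} {D : Ω → ℝ} (hD : Measurable D) {C : ℝ}
    (hDC : ∀ ω, |D ω| ≤ C)
    (horth : ∀ V : Ω → ℝ, Measurable V → (∃ B, ∀ ω, |V (T^[n] ω)| ≤ B) →
      ∫ ω, V (T^[n] ω) * D ω ∂μ = 0)
    {W W' : Ω → ℝ} (hW : Measurable W) (hW' : Measurable W') {B : ℝ} (hWB : ∀ ω, |W ω| ≤ B)
    (hWB' : ∀ ω, |W' ω| ≤ B) {b c : ℕ} (hbc : b + n ≤ c) :
    ∫ ω, W (T^[b + n] ω) * D (T^[b] ω) * (W' (T^[c + n] ω) * D (T^[c] ω)) ∂μ = 0 := by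
  obtain ⟨d, rfl⟩ := Nat.exists_eq_add_of_le hbc
  set V : Ω → ℝ := fun ω => W ω * (W' (T^[d + n] ω) * D (T^[d] ω)) with hV
  have hVm : Measurable V := hW.mul
    ((hW'.comp (hT.measurable.iterate _)).mul (hD.comp (hT.measurable.iterate _)))
  have hVb : ∀ ω, |V ω| ≤ B * (B * C) := fun ω => by
    have hB : 0 ≤ B := (abs_nonneg _).trans (hWB ω)
    simp only [hV, abs_mul]
    exact mul_le_mul (hWB _) (mul_le_mul (hWB' _) (hDC _) (abs_nonneg _) hB) (by positivity) hB
  have h0 := horth V hVm ⟨_, fun ω => hVb _⟩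
  have hm : Measurable fun ω => V (T^[n] ω) * D ω := (hVm.comp (hT.measurable.iterate n)).mul hD
  rw [← (hT.iterate b).map_eq, integral_map (hT.measurable.iterate b).aemeasurable
    hm.aestronglyMeasurable] at h0
  rw [← h0]
  refine integral_congr_ae (ae_of_all _ fun ω => ?_)
  simp only [hV, ← Function.iterate_add_apply]
  rw [show b + n + d + n = d + n + n + b by ring, show b + n + d = d + n + b by ring,
    add_comm b n]
  ring_nf

/-- Averages of `H k * F ∘ T^[a k]` tend to `0` almost everywhere when `F` is centred and `H k`
eventually only depends on the far future of `T^[a k]`. -/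
lemma Exact.ae_tendsto_average_mul_comp_iterate [IsProbabilityMeasure μ] (hexact : Exact T μ)
    (hT : MeasurePreserving T μ μ) (ha : Monotone a) (hak : ∀ k, a k ≤ k + 1)
    (ham : ∀ k, a k + 1 ≤ a (k + m)) {H : ℕ → Ω → ℝ} {B : ℝ} (hHm : ∀ k, Measurable (H k))
    (hHB : ∀ k ω, |H k ω| ≤ B)
    (hH : ∀ n, ∃ K, ∀ k ≥ K, ∃ W : Ω → ℝ, Measurable W ∧ (∀ ω, |W ω| ≤ B) ∧
      ∀ ω, H k ω = W (T^[a k + n] ω))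
    {F : Ω → ℝ} (hF : Measurable F) {C : ℝ} (hFC : ∀ ω, |F ω| ≤ C) (hF0 : ∫ ω, F ω ∂μ = 0) :
    ∀ᵐ ω ∂μ, Tendsto (fun N : ℕ => (∑ k ∈ Finset.range N, H k ω * F (T^[a k] ω)) / (N : ℝ))
      atTop (𝓝 0) := by
  refine ae_tendsto_zero_of_forall_exists_measure_le fun ε hε η hη => ?_
  obtain ⟨ω₀⟩ : Nonempty Ω := μ.nonempty_of_neZero
  have hB : 0 ≤ B := (abs_nonneg _).trans (hHB 0 ω₀)
  set δ : ℝ := ε / (4 * B * m + 1) with hδ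
  have hδ0 : 0 < δ := by positivity
  have hδε : B * m * (2 * δ) ≤ ε / 2 := by
    rw [hδ]
    have : 0 < 4 * B * m + 1 := by positivity
    field_simp
    nlinarith
  obtain ⟨n, Φ, hΦm, hΦC, hΦ, horth⟩ :=
    hexact.exists_small_of_centred hT.measurable hF hFC hF0 (mul_pos hη hδ0)
  have hΦi : Integrable (fun ω => |Φ ω|) μ :=
    (Integrable.of_bound hΦm.aestronglyMeasurable C (ae_of_all _ hΦC)).abs
  set D : Ω → ℝ := fun ω => F ω - Φ ω with hD
  have hDm : Measurable D := hF.sub hΦm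
  have hDC : ∀ ω, |D ω| ≤ C + C := fun ω =>
    (abs_sub _ _).trans (add_le_add (hFC ω) (hΦC ω))
  obtain ⟨K, hK⟩ := hH n
  have hjump : ∀ i j, a j + i ≤ a (j + m * i) := fun i j => by
    induction i with
    | zero => simp
    | succ i ih =>
      have := ham (j + m * i)
      rw [mul_add, mul_one, ← add_assoc j]
      omega
  have hlim := ae_tendsto_average_of_orthogonal (μ := μ) (K := K) (p := m * n)
    (X := fun k ω => H k ω * D (T^[a k] ω)) (C := B * (C + C))
    (fun k => (hHm k).mul (hDm.comp (hT.measurable.iterate _)))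
    (fun k ω => by
      rw [abs_mul]
      exact mul_le_mul (hHB k ω) (hDC _) (abs_nonneg _) hB)
    (fun j k hj hjk => by
      obtain ⟨W, hWm, hWB, hW⟩ := hK j hj
      obtain ⟨W', hWm', hWB', hW'⟩ := hK k (by omega)
      simp only [hW, hW']
      exact hT.integral_mul_comp_iterate_eq_zero hDm hDC horth hWm hWm' hWB hWB'
        ((hjump n j).trans (ha hjk)))
  refine ⟨{ω | ∃ N : ℕ, N * δ < birkhoffSum T (fun ω => |Φ ω|) N ω},
    (measure_exists_lt_birkhoffSum_le hT (hΦm.abs) hΦi (fun ω => abs_nonneg _) hδ0).trans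
      (ENNReal.ofReal_le_ofReal ((div_le_iff₀ hδ0).2 hΦ.le)), ?_⟩
  filter_upwards [hlim] with ω hω hωS
  simp only [not_exists, not_lt] at hωS
  filter_upwards [Metric.tendsto_nhds.1 hω (ε / 2) (half_pos hε), eventually_gt_atTop 0]
    with N hN hN0
  have hN1 : (1 : ℝ) ≤ N := by exact_mod_cast hN0
  rw [Real.dist_eq, sub_zero] at hN
  have hsmall : |∑ k ∈ Finset.range N, H k ω * Φ (T^[a k] ω)| ≤ ε / 2 * N := by
    calc |∑ k ∈ Finset.range N, H k ω * Φ (T^[a k] ω)|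
        ≤ ∑ k ∈ Finset.range N, |H k ω * Φ (T^[a k] ω)| := Finset.abs_sum_le_sum_abs _ _
      _ ≤ ∑ k ∈ Finset.range N, B * |Φ (T^[a k] ω)| := Finset.sum_le_sum fun k _ => by
          rw [abs_mul]
          exact mul_le_mul_of_nonneg_right (hHB k ω) (abs_nonneg _)
      _ = B * ∑ k ∈ Finset.range N, |Φ (T^[a k] ω)| := (Finset.mul_sum _ _ _).symm
      _ ≤ B * (m * ∑ i ∈ Finset.range (N + 1), |Φ (T^[i] ω)|) :=
          mul_le_mul_of_nonneg_left (sum_comp_le_mul_sum_range ha hak ham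
            (f := fun i => |Φ (T^[i] ω)|) (fun i => abs_nonneg _) N) hB
      _ ≤ B * (m * ((N + 1 : ℕ) * δ)) := by
          gcongr
          exact hωS (N + 1)
      _ ≤ B * (m * (2 * N * δ)) := by
          gcongr
          push_cast
          linarith
      _ = B * m * (2 * δ) * N := by ring
      _ ≤ ε / 2 * N := by gcongr
  have hsplit : (∑ k ∈ Finset.range N, H k ω * F (T^[a k] ω)) / (N : ℝ) =
      (∑ k ∈ Finset.range N, H k ω * D (T^[a k] ω)) / N +
        (∑ k ∈ Finset.range N, H k ω * Φ (T^[a k] ω)) / N := by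
    rw [← add_div, ← Finset.sum_add_distrib]
    simp only [hD]
    congr 1
    exact Finset.sum_congr rfl fun k _ => by ring
  have hsmall' : |(∑ k ∈ Finset.range N, H k ω * Φ (T^[a k] ω)) / (N : ℝ)| ≤ ε / 2 := by
    rw [abs_div, Nat.abs_cast]
    exact (div_le_iff₀ (by positivity)).2 hsmall
  rw [hsplit]
  exact (abs_add_le _ _).trans (by linarith)

end WeightedAverage

section FloorSequence

variable {α t : ℝ}

lemma lk_eq_natFloor (k : ℕ) : lk α t k = ⌊t + α * k⌋₊ := Int.floor_toNat _

lemma lk_mono (hα : 0 ≤ α) : Monotone (lk α t) := fun j k hjk => by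
  simp only [lk_eq_natFloor]
  gcongr

lemma lk_add_le (ht : 0 ≤ t) (hα : 0 ≤ α) {n k : ℕ} (h : t + α * k + n < k + 1) :
    lk α t k + n ≤ k := by
  rw [lk_eq_natFloor]
  have h1 : (⌊t + α * k⌋₊ : ℝ) ≤ t + α * k := Nat.floor_le (by positivity)
  have h2 : ((⌊t + α * k⌋₊ + n : ℕ) : ℝ) < (k + 1 : ℕ) := by
    push_cast
    linarith
  exact Nat.lt_succ_iff.1 (Nat.cast_lt.1 h2)

lemma lk_succ_le_lk_add (ht : 0 ≤ t) (hα : 0 ≤ α) {m : ℕ} (hm : 1 ≤ m * α) (k : ℕ) :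
    lk α t k + 1 ≤ lk α t (k + m) := by
  rw [lk_eq_natFloor, lk_eq_natFloor, ← Nat.floor_add_one (by positivity)]
  refine Nat.floor_mono ?_
  push_cast
  linarith

end FloorSequence

theorem stmt6 {Ω : Type*} [MeasurableSpace Ω]
    (T : Ω → Ω) (μ : Measure Ω) [IsProbabilityMeasure μ]
    (hT : MeasurePreserving T μ μ) (hwm : WeakMixing T μ) (hexact : Exact T μ)
    (α : ℝ) (hα : Irrational α) (hα01 : α ∈ Set.Ioo (0 : ℝ) 1)
    (I : Set ℝ) (hI : IsFinUnionIntervals I) (hI01 : I ⊆ Set.Ico (0 : ℝ) 1)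
    (F G : Ω → ℝ) (hFmeas : Measurable F) (hGmeas : Measurable G)
    (hFbd : ∃ C : ℝ, ∀ ω, |F ω| ≤ C) (hGbd : ∃ C : ℝ, ∀ ω, |G ω| ≤ C) :
    ∀ t ∈ Set.Ico (0 : ℝ) 1,
      ∃ Ω' : Set Ω, μ Ω' = 1 ∧ ∀ ω ∈ Ω',
        Tendsto (fun N : ℕ => (N : ℝ)⁻¹ *
            ∑ k ∈ Finset.Icc 1 N,
              Set.indicator I (1 : ℝ → ℝ) (Int.fract (t + k * α)) *
                F (T^[lk α t k] ω) * G (T^[k] ω))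
          atTop (𝓝 ((volume I).toReal * (∫ ω', F ω' ∂μ) * ∫ ω', G ω' ∂μ)) := by
  intro t ht
  obtain ⟨C, hC⟩ := hFbd
  obtain ⟨C', hC'⟩ := hGbd
  have hα0 : 0 ≤ α := hα01.1.le
  set c : ℝ := ∫ ω, F ω ∂μ with hc
  set d : ℝ := ∫ ω, G ω ∂μ with hd
  set φ : ℕ → ℝ := fun k => Set.indicator I (1 : ℝ → ℝ) (Int.fract (t + (k + 1 : ℕ) * α)) with hφ
  have hφ1 : ∀ k, |φ k| ≤ 1 := fun k => by
    by_cases h : Int.fract (t + (k + 1 : ℕ) * α) ∈ I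
    · simp only [hφ, Set.indicator_of_mem h, Pi.one_apply, abs_one, le_refl]
    · simp only [hφ, Set.indicator_of_notMem h, abs_zero, zero_le_one]
  have hcentred : ∀ {f : Ω → ℝ} {b : ℝ}, Measurable f → (∀ ω, |f ω| ≤ b) →
      ∫ ω, (f ω - ∫ ω', f ω' ∂μ) ∂μ = 0 := fun hf hb => by
    rw [integral_sub (Integrable.of_bound hf.aestronglyMeasurable _ (ae_of_all _ hb))
      (integrable_const _)]
    simp
  have hrotation : Tendsto (fun N : ℕ => (N : ℝ)⁻¹ * ∑ k ∈ Finset.range N, φ k) atTop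
      (𝓝 (volume I).toReal) := by
    obtain ⟨s, rfl⟩ := hI
    refine (tendsto_average_indicator_fract hα (t + α) s hI01).congr fun N => ?_
    simp only [hφ]
    congr 1
    refine Finset.sum_congr rfl fun k _ => ?_
    push_cast
    ring_nf
  have hfirst : ∀ᵐ ω ∂μ, Tendsto (fun N : ℕ => (∑ k ∈ Finset.range N,
      φ k * G (T^[k + 1] ω) * (F (T^[lk α t (k + 1)] ω) - c)) / (N : ℝ)) atTop (𝓝 0) := by
    obtain ⟨m, hm⟩ := exists_nat_ge (1 / α)
    have hm1 : 1 ≤ m * α := (div_le_iff₀ hα01.1).1 hm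
    refine hexact.ae_tendsto_average_mul_comp_iterate hT (a := fun k => lk α t (k + 1)) (m := m)
      (H := fun k ω => φ k * G (T^[k + 1] ω)) (B := C') (C := C + |c|) (fun j k hjk => lk_mono hα0 (by omega)) (fun k => ?_) (fun k => ?_)
      (fun k => measurable_const.mul (hGmeas.comp (hT.measurable.iterate _))) (fun k ω => ?_)
      (fun n => ?_) (F := fun ω => F ω - c) (hFmeas.sub_const c)
      (fun ω => (abs_sub _ _).trans (add_le_add_left (hC ω) _)) (hcentred hFmeas hC)
    · refine lk_add_le (n := 0) ht.1 hα0 ?_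
      have h1 := mul_le_mul_of_nonneg_right hα01.2.le ((k + 1 : ℕ).cast_nonneg (α := ℝ))
      rw [Nat.cast_zero]
      linarith [ht.2]
    · have := lk_succ_le_lk_add ht.1 hα0 hm1 (k + 1)
      rwa [add_right_comm] at this
    · rw [abs_mul]
      simpa using mul_le_mul (hφ1 k) (hC' (T^[k + 1] ω)) (abs_nonneg _) zero_le_one
    · obtain ⟨K, hK⟩ := exists_nat_ge (n / (1 - α))
      refine ⟨K, fun k hk => ?_⟩
      have h1 : (n : ℝ) ≤ K * (1 - α) := (div_le_iff₀ (by linarith [hα01.2])).1 hK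
      have h2 : (K : ℝ) * (1 - α) ≤ (k + 1 : ℕ) * (1 - α) :=
        mul_le_mul_of_nonneg_right (by exact_mod_cast hk.trans k.le_succ) (by linarith [hα01.2])
      obtain ⟨e, he⟩ := Nat.exists_eq_add_of_le'
        (lk_add_le (n := n) (k := k + 1) ht.1 hα0 (by linarith [ht.2]))
      refine ⟨fun ω => φ k * G (T^[e] ω),
        measurable_const.mul (hGmeas.comp (hT.measurable.iterate _)), fun ω => ?_, fun ω => ?_⟩
      · rw [abs_mul]
        simpa using mul_le_mul (hφ1 k) (hC' (T^[e] ω)) (abs_nonneg _) zero_le_one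
      · simp only [← Function.iterate_add_apply, ← he]
  have hsecond : ∀ᵐ ω ∂μ, Tendsto (fun N : ℕ => (∑ k ∈ Finset.range N,
      φ k * c * (G (T^[k + 1] ω) - d)) / (N : ℝ)) atTop (𝓝 0) := by
    have hb : ∀ k, |φ k * c| ≤ |c| := fun k => by
      rw [abs_mul]
      exact mul_le_of_le_one_left (abs_nonneg _) (hφ1 k)
    exact hexact.ae_tendsto_average_mul_comp_iterate hT (a := fun k => k + 1) (m := 1)
      (H := fun k _ => φ k * c) (B := |c|) (C := C' + |d|) (fun j k hjk => by simpa using hjk)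
      (fun k => le_rfl) (fun k => le_rfl) (fun k => measurable_const) (fun k _ => hb k)
      (fun n => ⟨0, fun k _ => ⟨fun _ => φ k * c, measurable_const, fun _ => hb k, fun _ => rfl⟩⟩)
      (F := fun ω => G ω - d) (hGmeas.sub_const d)
      (fun ω => (abs_sub _ _).trans (add_le_add_left (hC' ω) _)) (hcentred hGmeas hC')
  refine ⟨_, (measure_congr (eventuallyEq_univ.2 (hfirst.and hsecond))).trans measure_univ,
    fun ω hω => ?_⟩
  have hsum := (hω.1.add hω.2).add ((hrotation.mul_const c).mul_const d)
  rw [zero_add, zero_add] at hsum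
  refine hsum.congr fun N => ?_
  have hshift : Finset.Icc 1 N = Finset.Ico (0 + 1) (N + 1) := by
    ext k
    simp only [Finset.mem_Icc, Finset.mem_Ico]
    omega
  rw [hshift, ← Finset.sum_Ico_add', ← Finset.range_eq_Ico, div_eq_inv_mul, div_eq_inv_mul,
    mul_assoc, mul_assoc, ← mul_add, ← mul_add, Finset.sum_mul, ← Finset.sum_add_distrib,
    ← Finset.sum_add_distrib]
  congr 1
  refine Finset.sum_congr rfl fun k _ => ?_
  simp only [hφ]
  ring
end

section
/- Let Y ⊆ Σ^ℕ be a topologically transitive subshift of finite type, φ: Y → ℝ a Hölder function, and μ a shift-invariant probability measure on Y with the Gibbs property for φ. Then there is a constant K > 0 such that for all finite words a, a', b, c over Σ with [abc] ∩ Y ≠ ∅ and [a'bc] ∩ Y ≠ ∅: | (μ([abc]) · μ([a'b])) / (μ([ab]) · μ([a'bc])) − 1 | < K ρ^{|b|}. -/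
open MeasureTheory Filter Topology

/-- The one-sided shift on sequences. -/
def shiftN {A : Type*} (ω : ℕ → A) : ℕ → A := fun k => ω (k + 1)

/-- The concatenation `aω` of a finite word `a` with an infinite sequence `ω`. -/
def prepend {A : Type*} (a : List A) (ω : ℕ → A) : ℕ → A :=
  fun i => if h : i < a.length then a.get ⟨i, h⟩ else ω (i - a.length)

/-- The cylinder set `[a]` of sequences having the word `a` as a prefix. -/
def cylinder {A : Type*} (a : List A) : Set (ℕ → A) :=
  {ω | ∀ i : Fin a.length, ω i = a.get i}

/-- The Birkhoff sum `S_j^φ(ω) = ∑_{i=0}^{j-1} φ(T^i ω)`. -/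
def birkhoff {A : Type*} (φ : (ℕ → A) → ℝ) (j : ℕ) (ω : ℕ → A) : ℝ :=
  ∑ i ∈ Finset.range j, φ (shiftN^[i] ω)

/-- The subshift of finite type determined by a transition relation `M`. -/
def SFT {A : Type*} (M : A → A → Prop) : Set (ℕ → A) :=
  {ω | ∀ k : ℕ, M (ω k) (ω (k + 1))}

/-- Irreducibility of the transition relation `M` (equivalently, topological
transitivity of the subshift of finite type): any symbol can be joined to any
other by an admissible path of length `k ≥ 1`. -/
def IrreducibleTransition {A : Type*} (M : A → A → Prop) : Prop :=
  ∀ a b : A, ∃ k ≥ 1, ∃ p : ℕ → A, p 0 = a ∧ p k = b ∧ ∀ i < k, M (p i) (p (i + 1))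

/-- `φ` is Hölder on `Y` for the metric `d(ω,ω̃) = ρ^(min{k : ω_k ≠ ω̃_k})`:
if `ω, ω̃ ∈ Y` agree in their first `N` coordinates then `|φ ω - φ ω̃| ≤ K ρ^N`. -/
def IsHolder {A : Type*} (Y : Set (ℕ → A)) (φ : (ℕ → A) → ℝ) (ρ : ℝ) : Prop :=
  ∃ K > 0, ∀ ω ∈ Y, ∀ ω' ∈ Y, ∀ N : ℕ,
    (∀ i < N, ω i = ω' i) → |φ ω - φ ω'| ≤ K * ρ ^ N

/-- `μ` has the Gibbs property on `Y` for the potential `φ` and pressure `P`: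
`K⁻¹ ≤ μ([a]) / exp(-|a| P + S_{|a|}^φ(aω)) ≤ K` for every word `a` and
every `ω` with `aω ∈ Y`. -/
def HasGibbsProperty {A : Type*} [MeasurableSpace A]
    (Y : Set (ℕ → A)) (μ : MeasureTheory.Measure (ℕ → A)) (φ : (ℕ → A) → ℝ) (P : ℝ) : Prop :=
  ∃ K > 0, ∀ (a : List A) (ω : ℕ → A), prepend a ω ∈ Y →
    K⁻¹ * Real.exp (-(a.length : ℝ) * P + birkhoff φ a.length (prepend a ω)) ≤
        (μ (cylinder a)).toReal ∧
      (μ (cylinder a)).toReal ≤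
        K * Real.exp (-(a.length : ℝ) * P + birkhoff φ a.length (prepend a ω))

section WordSum

variable {A : Type*} [Fintype A]

/-- The sum of `f` over all words of length `k`. -/
noncomputable def wordSum (k : ℕ) (f : List A → ℝ) : ℝ := ∑ x : Fin k → A, f (List.ofFn x)

lemma wordSum_zero (f : List A → ℝ) : wordSum 0 f = f [] := by
  simp [wordSum]

lemma wordSum_sum (k : ℕ) (f : A → List A → ℝ) :
    wordSum k (fun x => ∑ i, f i x) = ∑ i, wordSum k (f i) :=
  Finset.sum_comm

lemma wordSum_succ (k : ℕ) (f : List A → ℝ) :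
    wordSum (k + 1) f = ∑ i, wordSum k (fun x => f (i :: x)) := by
  simp only [wordSum]
  rw [← Fintype.sum_prod_type' (fun (i : A) (x : Fin k → A) => f (i :: List.ofFn x))]
  exact (Fintype.sum_equiv (Fin.consEquiv (fun _ => A)) _ _
    (fun p => by simp [Fin.consEquiv, List.ofFn_succ])).symm

lemma wordSum_succ_cons (k : ℕ) (f : List A → ℝ) :
    wordSum (k + 1) f = wordSum k (fun x => ∑ i, f (i :: x)) := by
  rw [wordSum_succ, wordSum_sum]

lemma wordSum_succ_concat (k : ℕ) (f : List A → ℝ) :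
    wordSum (k + 1) f = wordSum k (fun x => ∑ i, f (x ++ [i])) := by
  induction k generalizing f with
  | zero => simp [wordSum_succ, wordSum_zero]
  | succ k ih =>
    rw [wordSum_succ, wordSum_succ]
    exact Finset.sum_congr rfl fun i _ => ih _

lemma wordSum_mono (k : ℕ) {f g : List A → ℝ} (h : ∀ x, f x ≤ g x) :
    wordSum k f ≤ wordSum k g :=
  Finset.sum_le_sum fun _ _ => h _

lemma wordSum_nonneg (k : ℕ) {f : List A → ℝ} (h : ∀ x, 0 ≤ f x) : 0 ≤ wordSum k f :=
  Finset.sum_nonneg fun _ _ => h _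

lemma wordSum_mul_left (k : ℕ) (c : ℝ) (f : List A → ℝ) :
    wordSum k (fun x => c * f x) = c * wordSum k f :=
  (Finset.mul_sum _ _ _).symm

lemma wordSum_add (k : ℕ) (f g : List A → ℝ) :
    wordSum k (fun x => f x + g x) = wordSum k f + wordSum k g :=
  Finset.sum_add_distrib

lemma wordSum_append_le (N : ℕ) (b : List A) {f : List A → ℝ} (hf : ∀ x, 0 ≤ f x) :
    wordSum N (fun y => f (b ++ y)) ≤ wordSum (N + b.length) f := by
  induction b generalizing f with
  | nil => simp
  | cons i b ih =>
    rw [List.length_cons, ← add_assoc, wordSum_succ]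
    exact (ih (f := fun x => f (i :: x)) fun x => hf _).trans
      (Finset.single_le_sum (f := fun j => wordSum (N + b.length) fun x => f (j :: x))
        (fun j _ => wordSum_nonneg _ fun x => hf _) (Finset.mem_univ i))

lemma wordSum_eq_of_cons {f : List A → ℝ} (hf : ∀ x, ∑ i, f (i :: x) = f x) (k : ℕ) :
    wordSum k f = f [] := by
  induction k with
  | zero => exact wordSum_zero f
  | succ k ih => rw [wordSum_succ_cons, funext hf, ih]

lemma wordSum_concat_eq {f : List A → ℝ} (hf : ∀ x, ∑ i, f (x ++ [i]) = f x) (b : List A)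
    (k : ℕ) : wordSum k (fun y => f (b ++ y)) = f b := by
  induction k with
  | zero => simp [wordSum_zero]
  | succ k ih =>
    rw [wordSum_succ_concat, ← ih]
    congr 1
    funext x
    simp only [← List.append_assoc, hf]

/-- `L²`-convergence of the martingale `m / q`, in finitary form: if `m` and `q` are additive
under prepending letters and `m ≤ C q`, then the conditional weights of a prepended letter
under `m` and `q` become equal in the `L¹`-limit. -/
lemma tendsto_wordSum_abs_sub {m q : List A → ℝ} {C : ℝ} (hm0 : ∀ x, 0 ≤ m x)
    (hq0 : ∀ x, 0 ≤ q x) (hC : 0 ≤ C) (hmq : ∀ x, m x ≤ C * q x)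
    (hm : ∀ x, ∑ i, m (i :: x) = m x) (hq : ∀ x, ∑ i, q (i :: x) = q x) :
    Tendsto (fun N => wordSum N fun x => ∑ i, |m (i :: x) - q (i :: x) / q x * m x|)
      atTop (𝓝 0) := by
  set r : List A → ℝ := fun x => m x / q x with hr
  have hrq : ∀ x, m x = q x * r x := by
    intro x
    rcases (hq0 x).eq_or_lt with h | h
    · have := hmq x
      rw [← h, mul_zero] at this
      rw [← h, zero_mul]
      exact le_antisymm this (hm0 x)
    · simp only [hr]; field_simp
  have hrC : ∀ x, r x ≤ C := by
    intro x
    rcases (hq0 x).eq_or_lt with h | h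
    · simp [hr, ← h, hC]
    · exact (div_le_iff₀ h).2 (hmq x)
  set B : ℕ → ℝ := fun N => wordSum N fun x => q x * r x ^ 2 with hB
  have hstep : ∀ N, B (N + 1) - B N =
      wordSum N fun x => ∑ i, q (i :: x) * (r (i :: x) - r x) ^ 2 := by
    intro N
    rw [sub_eq_iff_eq_add, hB]
    simp only
    rw [wordSum_succ_cons, ← wordSum_add]
    congr 1
    funext x
    have h1 : ∑ i, q (i :: x) * (r (i :: x) - r x) ^ 2 =
        ∑ i, q (i :: x) * r (i :: x) ^ 2 - 2 * r x * ∑ i, m (i :: x)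
          + r x ^ 2 * ∑ i, q (i :: x) := by
      rw [Finset.mul_sum, Finset.mul_sum, ← Finset.sum_sub_distrib, ← Finset.sum_add_distrib]
      refine Finset.sum_congr rfl fun i _ => ?_
      rw [hrq (i :: x)]; ring
    rw [h1, hm, hq, hrq x]; ring
  have hmono : Monotone B := monotone_nat_of_le_succ fun N => by
    have := hstep N
    have h2 : 0 ≤ wordSum N fun x => ∑ i, q (i :: x) * (r (i :: x) - r x) ^ 2 :=
      wordSum_nonneg _ fun x => Finset.sum_nonneg fun i _ => mul_nonneg (hq0 _) (sq_nonneg _)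
    linarith
  have hbdd : BddAbove (Set.range B) := by
    refine ⟨C * m [], ?_⟩
    rintro _ ⟨N, rfl⟩
    rw [← wordSum_eq_of_cons hm N, ← wordSum_mul_left]
    refine wordSum_mono _ fun x => ?_
    have := mul_le_mul_of_nonneg_left (hrC x) (hm0 x)
    calc q x * r x ^ 2 = m x * r x := by rw [hrq x]; ring
      _ ≤ C * m x := by linarith
  have hlim := tendsto_atTop_ciSup hmono hbdd
  have hdiff : Tendsto (fun N => B (N + 1) - B N) atTop (𝓝 0) := by
    simpa using ((tendsto_add_atTop_iff_nat 1).2 hlim).sub hlim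
  rw [Metric.tendsto_atTop]
  intro ε hε
  set δ : ℝ := ε / (2 * (q [] + 1)) with hδ
  have hq1 : 0 < q [] + 1 := by linarith [hq0 []]
  have hδ0 : 0 < δ := by positivity
  obtain ⟨N₀, hN₀⟩ := Metric.tendsto_atTop.1 hdiff (δ * (ε / 2)) (by positivity)
  refine ⟨N₀, fun N hN => ?_⟩
  have h1 := hN₀ N hN
  rw [Real.dist_eq, sub_zero] at h1 ⊢
  rw [abs_of_nonneg (wordSum_nonneg _ fun x => Finset.sum_nonneg fun i _ => abs_nonneg _)]
  have key : (wordSum N fun x => ∑ i, |m (i :: x) - q (i :: x) / q x * m x|) ≤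
      δ * q [] + δ⁻¹ * (B (N + 1) - B N) := by
    rw [hstep, ← wordSum_eq_of_cons hq N, ← wordSum_mul_left, ← wordSum_mul_left, ← wordSum_add]
    refine wordSum_mono _ fun x => ?_
    rw [← hq x, Finset.mul_sum, Finset.mul_sum, ← Finset.sum_add_distrib]
    refine Finset.sum_le_sum fun i _ => ?_
    have e1 : m (i :: x) - q (i :: x) / q x * m x = q (i :: x) * (r (i :: x) - r x) := by
      rw [hrq (i :: x)]; simp only [hr]; ring
    rw [hq x, e1, abs_mul, abs_of_nonneg (hq0 _)]
    have e2 : |r (i :: x) - r x| ≤ δ + δ⁻¹ * (r (i :: x) - r x) ^ 2 := by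
      rw [← sq_abs (r (i :: x) - r x)]
      set t := |r (i :: x) - r x|
      have : δ + δ⁻¹ * t ^ 2 - t = δ⁻¹ * ((δ - t / 2) ^ 2 + 3 / 4 * t ^ 2) := by
        field_simp; ring
      have : 0 ≤ δ⁻¹ * ((δ - t / 2) ^ 2 + 3 / 4 * t ^ 2) := by positivity
      linarith
    have := mul_le_mul_of_nonneg_left e2 (hq0 (i :: x))
    linarith
  have h2 : B (N + 1) - B N < δ * (ε / 2) := (le_abs_self _).trans_lt h1
  have h3 : δ⁻¹ * (B (N + 1) - B N) < ε / 2 := by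
    rw [inv_mul_lt_iff₀ hδ0]; exact h2
  have h4 : δ * q [] ≤ ε / 2 := by
    rw [hδ, div_mul_eq_mul_div, div_le_div_iff₀ (by positivity) (by norm_num)]
    nlinarith
  linarith

end WordSum

section Prepend

variable {A : Type*}

@[simp] lemma prepend_nil (ω : ℕ → A) : prepend [] ω = ω := by
  funext i; simp [prepend]

lemma prepend_cons_zero (i : A) (w : List A) (ω : ℕ → A) : prepend (i :: w) ω 0 = i := by
  simp [prepend]

lemma prepend_cons_succ (i : A) (w : List A) (ω : ℕ → A) (k : ℕ) :
    prepend (i :: w) ω (k + 1) = prepend w ω k := by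
  simp [prepend]

lemma shiftN_prepend_cons (i : A) (w : List A) (ω : ℕ → A) :
    shiftN (prepend (i :: w) ω) = prepend w ω :=
  funext fun k => prepend_cons_succ i w ω k

lemma prepend_singleton_shiftN (ω : ℕ → A) : prepend [ω 0] (shiftN ω) = ω := by
  funext k
  cases k with
  | zero => rw [prepend_cons_zero]
  | succ k => rw [prepend_cons_succ, prepend_nil]; rfl

lemma prepend_append (v w : List A) (ω : ℕ → A) :
    prepend (v ++ w) ω = prepend v (prepend w ω) := by
  induction v with
  | nil => simp
  | cons i v ih =>
    funext k
    cases k with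
    | zero => simp [prepend_cons_zero]
    | succ k => rw [List.cons_append, prepend_cons_succ, prepend_cons_succ, ih]

lemma prepend_cons (i : A) (w : List A) (ω : ℕ → A) :
    prepend (i :: w) ω = prepend [i] (prepend w ω) :=
  prepend_append [i] w ω

lemma prepend_eq_of_lt (w : List A) (ω ω' : ℕ → A) {i : ℕ} (h : i < w.length) :
    prepend w ω i = prepend w ω' i := by
  simp [prepend, h]

lemma mem_cylinder_cons (i : A) (w : List A) (ω : ℕ → A) :
    ω ∈ cylinder (i :: w) ↔ ω 0 = i ∧ shiftN ω ∈ cylinder w := by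
  constructor
  · intro h
    exact ⟨h ⟨0, by simp⟩, fun j => h j.succ⟩
  · rintro ⟨h0, h⟩ ⟨j, hj⟩
    cases j with
    | zero => exact h0
    | succ j => exact h ⟨j, by simpa using hj⟩

lemma mem_cylinder_iff (w : List A) (ω : ℕ → A) :
    ω ∈ cylinder w ↔ ∃ ω', ω = prepend w ω' := by
  induction w generalizing ω with
  | nil => simp [_root_.cylinder]
  | cons i w ih =>
    rw [mem_cylinder_cons, ih]
    constructor
    · rintro ⟨rfl, ω', h⟩
      exact ⟨ω', by rw [prepend_cons, ← h, prepend_singleton_shiftN]⟩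
    · rintro ⟨ω', rfl⟩
      exact ⟨prepend_cons_zero i w ω', ω', shiftN_prepend_cons i w ω'⟩

lemma cylinder_inter_nonempty_iff (w : List A) (Y : Set (ℕ → A)) :
    (cylinder w ∩ Y).Nonempty ↔ ∃ ω, prepend w ω ∈ Y := by
  constructor
  · rintro ⟨ω, h, hY⟩
    obtain ⟨ω', rfl⟩ := (mem_cylinder_iff w ω).1 h
    exact ⟨ω', hY⟩
  · rintro ⟨ω, h⟩
    exact ⟨_, (mem_cylinder_iff w _).2 ⟨ω, rfl⟩, h⟩

lemma prepend_cons_mem_SFT {M : A → A → Prop} {i : A} {w : List A} {ω : ℕ → A} :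
    prepend (i :: w) ω ∈ SFT M ↔ M i (prepend w ω 0) ∧ prepend w ω ∈ SFT M := by
  constructor
  · intro h
    refine ⟨?_, fun k => ?_⟩
    · simpa only [prepend_cons_zero, prepend_cons_succ] using h 0
    · simpa only [prepend_cons_succ] using h (k + 1)
  · rintro ⟨h0, h⟩ k
    cases k with
    | zero => simpa only [prepend_cons_zero, prepend_cons_succ] using h0
    | succ k => simpa only [prepend_cons_succ] using h k

lemma mem_SFT_of_prepend_mem {M : A → A → Prop} {w : List A} {ω : ℕ → A}
    (h : prepend w ω ∈ SFT M) : ω ∈ SFT M := by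
  induction w with
  | nil => simpa using h
  | cons i w ih => exact ih (prepend_cons_mem_SFT.1 h).2

lemma prepend_mem_SFT_of_head_eq {M : A → A → Prop} {w : List A} {ω ω' : ℕ → A}
    (h : prepend w ω ∈ SFT M) (h' : ω' ∈ SFT M) (h0 : ω 0 = ω' 0) :
    prepend w ω' ∈ SFT M := by
  induction w with
  | nil => simpa using h'
  | cons i w ih =>
    rw [prepend_cons_mem_SFT] at h ⊢
    refine ⟨?_, ih h.2⟩
    have : prepend w ω' 0 = prepend w ω 0 := by
      cases w with
      | nil => simp [h0]
      | cons j w => simp only [prepend_cons_zero]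
    rw [this]; exact h.1

lemma prepend_head_eq {b : List A} (hb : b ≠ []) (ω ω' : ℕ → A) :
    prepend b ω 0 = prepend b ω' 0 :=
  prepend_eq_of_lt b ω ω' (List.length_pos_iff.2 hb)

end Prepend

section Weight

variable {A : Type*}

/-- The normalized Gibbs weight `exp (S_{|w|}^φ(wω) - |w| P)`. -/
noncomputable def gibbsWeight (φ : (ℕ → A) → ℝ) (P : ℝ) : List A → (ℕ → A) → ℝ
  | [], _ => 1
  | i :: w, ω => Real.exp (φ (prepend (i :: w) ω) - P) * gibbsWeight φ P w ω

lemma gibbsWeight_pos (φ : (ℕ → A) → ℝ) (P : ℝ) (w : List A) (ω : ℕ → A) :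
    0 < gibbsWeight φ P w ω := by
  induction w with
  | nil => exact one_pos
  | cons i w ih => exact mul_pos (Real.exp_pos _) ih

lemma gibbsWeight_append (φ : (ℕ → A) → ℝ) (P : ℝ) (v w : List A) (ω : ℕ → A) :
    gibbsWeight φ P (v ++ w) ω = gibbsWeight φ P v (prepend w ω) * gibbsWeight φ P w ω := by
  induction v with
  | nil => simp [gibbsWeight]
  | cons i v ih =>
    rw [List.cons_append, gibbsWeight, gibbsWeight, ih, ← List.cons_append, prepend_append,
      mul_assoc]

lemma gibbsWeight_eq (φ : (ℕ → A) → ℝ) (P : ℝ) (w : List A) (ω : ℕ → A) :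
    gibbsWeight φ P w ω =
      Real.exp (-(w.length : ℝ) * P + birkhoff φ w.length (prepend w ω)) := by
  induction w with
  | nil => simp [gibbsWeight, birkhoff]
  | cons i w ih =>
    rw [gibbsWeight, ih, ← Real.exp_add]
    congr 1
    have : birkhoff φ (i :: w).length (prepend (i :: w) ω) =
        birkhoff φ w.length (prepend w ω) + φ (prepend (i :: w) ω) := by
      simp only [birkhoff, List.length_cons, Finset.sum_range_succ', Function.iterate_succ_apply,
        shiftN_prepend_cons, Function.iterate_zero, id_eq]
    rw [this, List.length_cons]
    push_cast
    ring

lemma gibbsWeight_le_exp_mul {M : A → A → Prop} {φ : (ℕ → A) → ℝ} {P ρ K : ℝ}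
    (hρ : ρ ∈ Set.Ioo (0 : ℝ) 1) (hK : 0 < K)
    (hφ : ∀ (w : List A) (ξ ξ' : ℕ → A), prepend w ξ ∈ SFT M → prepend w ξ' ∈ SFT M →
      φ (prepend w ξ) ≤ φ (prepend w ξ') + K * ρ ^ w.length)
    (x b : List A) {ξ ξ' : ℕ → A} (h : prepend x (prepend b ξ) ∈ SFT M)
    (h' : prepend x (prepend b ξ') ∈ SFT M) :
    gibbsWeight φ P x (prepend b ξ) ≤
      Real.exp (K / (1 - ρ) * ρ ^ b.length * (1 - ρ ^ x.length)) *
        gibbsWeight φ P x (prepend b ξ') := by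
  have h1ρ : 0 < 1 - ρ := by linarith [hρ.2]
  induction x with
  | nil => simp [gibbsWeight]
  | cons i x ih =>
    have hx := ih (prepend_cons_mem_SFT.1 h).2 (prepend_cons_mem_SFT.1 h').2
    have h2 := hφ (i :: x ++ b) ξ ξ' (by rwa [prepend_append]) (by rwa [prepend_append])
    rw [prepend_append, prepend_append] at h2
    have h3 : K * ρ ^ (i :: x ++ b).length ≤
        K / (1 - ρ) * ρ ^ b.length * (1 - ρ ^ (i :: x).length) -
          K / (1 - ρ) * ρ ^ b.length * (1 - ρ ^ x.length) := by
      have e : K / (1 - ρ) * ρ ^ b.length * (1 - ρ ^ (i :: x).length) -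
          K / (1 - ρ) * ρ ^ b.length * (1 - ρ ^ x.length) = K * ρ ^ (x.length + b.length) := by
        rw [List.length_cons, pow_succ, pow_add]; field_simp; ring
      rw [e]
      refine mul_le_mul_of_nonneg_left ?_ hK.le
      exact pow_le_pow_of_le_one hρ.1.le hρ.2.le (by simp)
    calc gibbsWeight φ P (i :: x) (prepend b ξ)
        = Real.exp (φ (prepend (i :: x) (prepend b ξ)) - P) *
            gibbsWeight φ P x (prepend b ξ) := rfl
      _ ≤ Real.exp (K / (1 - ρ) * ρ ^ b.length * (1 - ρ ^ (i :: x).length) -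
            K / (1 - ρ) * ρ ^ b.length * (1 - ρ ^ x.length) +
              (φ (prepend (i :: x) (prepend b ξ')) - P)) *
            (Real.exp (K / (1 - ρ) * ρ ^ b.length * (1 - ρ ^ x.length)) *
              gibbsWeight φ P x (prepend b ξ')) := by
          refine mul_le_mul (Real.exp_le_exp.2 (by linarith)) hx (gibbsWeight_pos _ _ _ _).le
            (Real.exp_pos _).le
      _ = _ := by
          rw [gibbsWeight, ← mul_assoc, ← Real.exp_add, ← mul_assoc, ← Real.exp_add]
          congr 2
          ring

end Weight

section CylinderMass

variable {A : Type*} [MeasurableSpace A]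

lemma measurable_shiftN : Measurable (shiftN : (ℕ → A) → ℕ → A) :=
  measurable_pi_lambda _ fun k => measurable_pi_apply (k + 1)

variable [DiscreteMeasurableSpace A]

lemma measurableSet_cylinder_word (w : List A) : MeasurableSet (_root_.cylinder w) := by
  have : _root_.cylinder w = ⋂ i : Fin w.length, (fun ω : ℕ → A => ω i) ⁻¹' {w.get i} := by
    ext ω; simp [_root_.cylinder]
  rw [this]
  exact MeasurableSet.iInter fun i => measurable_pi_apply _ (MeasurableSet.of_discrete)

lemma exists_prepend_mem_of_measureReal_pos (μ : Measure (ℕ → A)) [IsProbabilityMeasure μ]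
    {Y : Set (ℕ → A)} (hsupp : μ Y = 1) {w : List A} (hw : 0 < μ.real (_root_.cylinder w)) :
    ∃ ω, prepend w ω ∈ Y := by
  rw [← cylinder_inter_nonempty_iff]
  by_contra h
  rw [Set.not_nonempty_iff_eq_empty] at h
  have hsub : Y ⊆ (_root_.cylinder w)ᶜ := fun ω hω hc => by
    have : ω ∈ _root_.cylinder w ∩ Y := ⟨hc, hω⟩
    rw [h] at this; exact this
  have h1 : μ (_root_.cylinder w)ᶜ = 1 :=
    le_antisymm prob_le_one (hsupp ▸ measure_mono hsub)
  rw [prob_compl_eq_one_iff (measurableSet_cylinder_word w)] at h1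
  simp [measureReal_def, h1] at hw

variable [Fintype A]

lemma sum_measureReal_inter_coord (μ : Measure (ℕ → A)) [IsFiniteMeasure μ] (k : ℕ)
    (S : Set (ℕ → A)) : ∑ i, μ.real (S ∩ {ω | ω k = i}) = μ.real S := by
  have hm : ∀ i, MeasurableSet {ω : ℕ → A | ω k = i} := fun i =>
    show MeasurableSet ((fun ω : ℕ → A => ω k) ⁻¹' {i}) from
      measurable_pi_apply k MeasurableSet.of_discrete
  have := measureReal_biUnion_finset (μ := μ.restrict S) (s := Finset.univ)
    (f := fun i => {ω : ℕ → A | ω k = i})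
    (fun i _ j _ hij => Set.disjoint_left.2 fun ω h1 h2 => hij (h1.symm.trans h2))
    (fun i _ => hm i)
  have hU : (⋃ i ∈ (Finset.univ : Finset A), {ω : ℕ → A | ω k = i}) = Set.univ := by
    ext ω; simp
  rw [hU, measureReal_restrict_apply_univ] at this
  rw [this]
  refine Finset.sum_congr rfl fun i _ => ?_
  rw [measureReal_restrict_apply (hm i), Set.inter_comm]

lemma sum_measureReal_cylinder_cons (μ : Measure (ℕ → A)) [IsFiniteMeasure μ]
    (hinv : μ.map shiftN = μ) (w : List A) :
    ∑ i, μ.real (_root_.cylinder (i :: w)) = μ.real (_root_.cylinder w) := by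
  have h : μ.real (_root_.cylinder w) = μ.real (shiftN ⁻¹' _root_.cylinder w) := by
    conv_lhs => rw [← hinv]
    exact map_measureReal_apply measurable_shiftN (measurableSet_cylinder_word w)
  rw [h, ← sum_measureReal_inter_coord μ 0]
  refine Finset.sum_congr rfl fun i _ => ?_
  congr 1
  ext ω
  rw [mem_cylinder_cons]
  exact and_comm

lemma mem_cylinder_concat {A : Type*} (w : List A) (i : A) (ω : ℕ → A) :
    ω ∈ _root_.cylinder (w ++ [i]) ↔ ω ∈ _root_.cylinder w ∧ ω w.length = i := by
  induction w generalizing ω with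
  | nil => simp [_root_.cylinder]
  | cons j w ih =>
    rw [List.cons_append, mem_cylinder_cons, ih, mem_cylinder_cons, and_assoc]
    rfl

lemma sum_measureReal_cylinder_concat (μ : Measure (ℕ → A)) [IsFiniteMeasure μ] (w : List A) :
    ∑ i, μ.real (_root_.cylinder (w ++ [i])) = μ.real (_root_.cylinder w) := by
  rw [← sum_measureReal_inter_coord μ w.length]
  refine Finset.sum_congr rfl fun i _ => ?_
  congr 1
  ext ω
  exact mem_cylinder_concat w i ω

end CylinderMass

/-- The properties of the cylinder masses `m w = μ [w]` of a shift-invariant measure on `SFT M`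
with the Gibbs property (constant `K`) for a potential `φ` which is Hölder (constant `L`). -/
structure IsGibbsMass {A : Type*} [Fintype A] (M : A → A → Prop) (φ : (ℕ → A) → ℝ)
    (P ρ L K : ℝ) (m : List A → ℝ) : Prop where
  ρ_mem : ρ ∈ Set.Ioo (0 : ℝ) 1
  L_pos : 0 < L
  K_pos : 0 < K
  holder : ∀ (w : List A) (ξ ξ' : ℕ → A), prepend w ξ ∈ SFT M → prepend w ξ' ∈ SFT M →
    φ (prepend w ξ) ≤ φ (prepend w ξ') + L * ρ ^ w.length
  nonneg : ∀ w, 0 ≤ m w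
  nil : m [] = 1
  sum_cons : ∀ w, ∑ i, m (i :: w) = m w
  sum_concat : ∀ w, ∑ i, m (w ++ [i]) = m w
  exists_mem : ∀ w, 0 < m w → ∃ ω, prepend w ω ∈ SFT M
  lower : ∀ w ω, prepend w ω ∈ SFT M → K⁻¹ * gibbsWeight φ P w ω ≤ m w
  upper : ∀ w ω, prepend w ω ∈ SFT M → m w ≤ K * gibbsWeight φ P w ω

namespace IsGibbsMass

variable {A : Type*} [Fintype A] {M : A → A → Prop} {φ : (ℕ → A) → ℝ} {P ρ L K : ℝ}
  {m : List A → ℝ}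

lemma pos (H : IsGibbsMass M φ P ρ L K m) {w : List A} {ω : ℕ → A}
    (h : prepend w ω ∈ SFT M) : 0 < m w :=
  (mul_pos (inv_pos.2 H.K_pos) (gibbsWeight_pos φ P w ω)).trans_le (H.lower w ω h)

lemma eq_zero (H : IsGibbsMass M φ P ρ L K m) {w : List A}
    (h : ∀ ω, prepend w ω ∉ SFT M) : m w = 0 := by
  by_contra h0
  obtain ⟨ω, hω⟩ := H.exists_mem w ((H.nonneg w).lt_of_ne' h0)
  exact h ω hω

lemma concat_le (H : IsGibbsMass M φ P ρ L K m) (w : List A) (i : A) : m (w ++ [i]) ≤ m w := by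
  rw [← H.sum_concat w]
  exact Finset.single_le_sum (f := fun i => m (w ++ [i])) (fun _ _ => H.nonneg _)
    (Finset.mem_univ i)

/-- A word followed by `ω 0` has mass zero unless it can be followed by `ω`. -/
lemma concat_eq_zero (H : IsGibbsMass M φ P ρ L K m) {w : List A} {ω : ℕ → A}
    (hω : ω ∈ SFT M) (h : prepend w ω ∉ SFT M) : m (w ++ [ω 0]) = 0 := by
  refine H.eq_zero fun ω' hω' => h ?_
  rw [prepend_append] at hω'
  exact prepend_mem_SFT_of_head_eq hω' hω (prepend_cons_zero _ _ _)

end IsGibbsMass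

lemma exists_cesaro_limit {X : Type*} {f : ℕ → X → ℝ} {K : ℝ} (h0 : ∀ k x, 0 ≤ f k x)
    (hK0 : 0 ≤ K) (hK : ∀ k x, f k x ≤ K) :
    ∃ (U : Ultrafilter ℕ) (h : X → ℝ), (U : Filter ℕ) ≤ atTop ∧
      ∀ x, Tendsto (fun N : ℕ => (∑ k ∈ Finset.range N, f k x) / N) U (𝓝 (h x)) := by
  have hU : ((hyperfilter ℕ : Ultrafilter ℕ) : Filter ℕ) ≤ atTop :=
    Nat.cofinite_eq_atTop ▸ hyperfilter_le_cofinite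
  have : ∀ x, ∃ y, Tendsto (fun N : ℕ => (∑ k ∈ Finset.range N, f k x) / N)
      (hyperfilter ℕ : Ultrafilter ℕ) (𝓝 y) := by
    intro x
    have hmem : ∀ N : ℕ, (∑ k ∈ Finset.range N, f k x) / N ∈ Set.Icc 0 K := fun N => by
      refine ⟨div_nonneg (Finset.sum_nonneg fun k _ => h0 k x) N.cast_nonneg, ?_⟩
      refine div_le_of_le_mul₀ N.cast_nonneg hK0 ?_
      refine (Finset.sum_le_sum fun k _ => hK k x).trans ?_
      simp [mul_comm]
    obtain ⟨y, -, hy⟩ := isCompact_Icc.ultrafilter_le_nhds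
      ((hyperfilter ℕ).map fun N : ℕ => (∑ k ∈ Finset.range N, f k x) / N)
      (le_principal_iff.2 (Filter.mem_map.2 (Filter.univ_mem' hmem)))
    exact ⟨y, hy⟩
  choose h hh using this
  exact ⟨hyperfilter ℕ, h, hU, hh⟩

section TransferOperator

variable {A : Type*} [Fintype A]

open Classical in
/-- The `k`-th iterate of the normalized transfer operator, applied to the indicator function
of the subshift. -/
noncomputable def transferIterate (M : A → A → Prop) (φ : (ℕ → A) → ℝ) (P : ℝ) (k : ℕ)
    (ω : ℕ → A) : ℝ :=
  wordSum k fun x => if prepend x ω ∈ SFT M then gibbsWeight φ P x ω else 0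

lemma transferIterate_nonneg (M : A → A → Prop) (φ : (ℕ → A) → ℝ) (P : ℝ) (k : ℕ)
    (ω : ℕ → A) : 0 ≤ transferIterate M φ P k ω :=
  wordSum_nonneg _ fun x => by
    split_ifs
    · exact (gibbsWeight_pos φ P x ω).le
    · exact le_rfl

lemma transferIterate_of_notMem {M : A → A → Prop} (φ : (ℕ → A) → ℝ) (P : ℝ) (k : ℕ)
    {ω : ℕ → A} (hω : ω ∉ SFT M) : transferIterate M φ P k ω = 0 := by
  have : ∀ x, prepend x ω ∉ SFT M := fun x hx => hω (mem_SFT_of_prepend_mem hx)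
  simp [transferIterate, wordSum, this]

lemma transferIterate_succ (M : A → A → Prop) (φ : (ℕ → A) → ℝ) (P : ℝ) (k : ℕ)
    (ω : ℕ → A) : ∑ i, Real.exp (φ (prepend [i] ω) - P) * transferIterate M φ P k (prepend [i] ω)
      = transferIterate M φ P (k + 1) ω := by
  rw [transferIterate, wordSum_succ_concat, wordSum_sum]
  refine Finset.sum_congr rfl fun i _ => ?_
  rw [transferIterate, ← wordSum_mul_left]
  congr 1
  funext x
  rw [prepend_append, gibbsWeight_append, mul_ite, mul_zero]
  simp only [gibbsWeight, mul_one]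
  rw [mul_comm]

end TransferOperator

namespace IsGibbsMass

variable {A : Type*} [Fintype A] {M : A → A → Prop} {φ : (ℕ → A) → ℝ} {P ρ L K : ℝ}
  {m : List A → ℝ}

lemma transferIterate_le (H : IsGibbsMass M φ P ρ L K m) (k : ℕ) (ω : ℕ → A) :
    transferIterate M φ P k ω ≤ K := by
  have : K = wordSum k fun x => K * m x := by
    rw [wordSum_mul_left, wordSum_eq_of_cons H.sum_cons, H.nil, mul_one]
  rw [this]
  refine wordSum_mono _ fun x => ?_
  split_ifs with h
  · exact (inv_mul_le_iff₀ H.K_pos).1 (H.lower x ω h)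
  · exact mul_nonneg H.K_pos.le (H.nonneg _)

lemma exists_le_transferIterate (H : IsGibbsMass M φ P ρ L K m) :
    ∃ c > 0, ∀ k, ∀ ω ∈ SFT M, c ≤ transferIterate M φ P k ω := by
  obtain ⟨c, hc, hcm⟩ : ∃ c > 0, ∀ i, 0 < m [i] → c ≤ m [i] := by
    have hf : ({i : A | 0 < m [i]} : Set A).Finite := Set.toFinite _
    rcases Set.eq_empty_or_nonempty {i : A | 0 < m [i]} with he | hne
    · exact ⟨1, one_pos, fun i hi => absurd (show i ∈ {i : A | 0 < m [i]} from hi) (by simp [he])⟩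
    · obtain ⟨j, hj, hmin⟩ := Set.exists_min_image _ (fun i => m [i]) hf hne
      exact ⟨m [j], hj, hmin⟩
  refine ⟨K⁻¹ * c, mul_pos (inv_pos.2 H.K_pos) hc, fun k ω hω => ?_⟩
  have hpos : 0 < m [ω 0] := H.pos (ω := shiftN ω) (by rwa [prepend_singleton_shiftN])
  have e : m [ω 0] = wordSum k fun x => m (x ++ [ω 0]) :=
    (wordSum_eq_of_cons (f := fun x => m (x ++ [ω 0])) (fun x => H.sum_cons _) k).symm
  calc K⁻¹ * c ≤ K⁻¹ * m [ω 0] :=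
        mul_le_mul_of_nonneg_left (hcm _ hpos) (inv_nonneg.2 H.K_pos.le)
    _ = wordSum k fun x => K⁻¹ * m (x ++ [ω 0]) := by rw [wordSum_mul_left, e]
    _ ≤ transferIterate M φ P k ω := by
        refine wordSum_mono _ fun x => ?_
        split_ifs with h
        · rw [inv_mul_le_iff₀ H.K_pos]
          exact (H.concat_le x _).trans (H.upper x ω h)
        · rw [H.concat_eq_zero hω h, mul_zero]

lemma transferIterate_le_exp_mul (H : IsGibbsMass M φ P ρ L K m) (k : ℕ) {b : List A}
    (hb : b ≠ []) {ξ ξ' : ℕ → A} (h' : prepend b ξ' ∈ SFT M) :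
    transferIterate M φ P k (prepend b ξ) ≤
      Real.exp (L / (1 - ρ) * ρ ^ b.length) * transferIterate M φ P k (prepend b ξ') := by
  have h1ρ : 0 < 1 - ρ := by linarith [H.ρ_mem.2]
  rw [transferIterate, transferIterate, ← wordSum_mul_left]
  refine wordSum_mono _ fun x => ?_
  by_cases hx : prepend x (prepend b ξ) ∈ SFT M
  · have hx' := prepend_mem_SFT_of_head_eq hx h' (prepend_head_eq hb ξ ξ')
    rw [if_pos hx, if_pos hx']
    refine (gibbsWeight_le_exp_mul H.ρ_mem H.L_pos H.holder x b hx hx').trans ?_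
    refine mul_le_mul_of_nonneg_right (Real.exp_le_exp.2 ?_) (gibbsWeight_pos _ _ _ _).le
    have hL : 0 ≤ L / (1 - ρ) * ρ ^ b.length := by
      have := H.L_pos; have := H.ρ_mem.1; positivity
    have : 0 ≤ ρ ^ x.length := pow_nonneg H.ρ_mem.1.le _
    nlinarith
  · rw [if_neg hx]
    refine mul_nonneg (Real.exp_pos _).le ?_
    split_ifs
    · exact (gibbsWeight_pos _ _ _ _).le
    · exact le_rfl

/-- A positive eigenfunction of the transfer operator with Lipschitz logarithm. -/
theorem exists_eigenfunction (H : IsGibbsMass M φ P ρ L K m) :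
    ∃ h : (ℕ → A) → ℝ, ∃ c > 0, (∀ ω ∉ SFT M, h ω = 0) ∧ (∀ ω ∈ SFT M, c ≤ h ω) ∧
      (∀ ω, ∑ i, Real.exp (φ (prepend [i] ω) - P) * h (prepend [i] ω) = h ω) ∧
      ∀ b : List A, b ≠ [] → ∀ ξ ξ', prepend b ξ' ∈ SFT M →
        h (prepend b ξ) ≤ Real.exp (L / (1 - ρ) * ρ ^ b.length) * h (prepend b ξ') := by
  obtain ⟨c, hc, hlow⟩ := H.exists_le_transferIterate
  obtain ⟨U, h, hU, hlim⟩ := exists_cesaro_limit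
    (transferIterate_nonneg M φ P) H.K_pos.le H.transferIterate_le
  refine ⟨h, c, hc, fun ω hω => ?_, fun ω hω => ?_, fun ω => ?_, fun b hb ξ ξ' hξ' => ?_⟩
  · refine tendsto_nhds_unique (hlim ω) ?_
    simp [transferIterate_of_notMem φ P _ hω]
  · refine ge_of_tendsto (hlim ω) (hU ?_)
    filter_upwards [eventually_gt_atTop 0] with N hN
    rw [le_div_iff₀ (by exact_mod_cast hN)]
    have := Finset.sum_le_sum fun k (_ : k ∈ Finset.range N) => hlow k ω hω
    simpa [mul_comm] using this
  · refine tendsto_nhds_unique (tendsto_finsetSum (f := fun i (N : ℕ) =>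
      Real.exp (φ (prepend [i] ω) - P) *
        ((∑ k ∈ Finset.range N, transferIterate M φ P k (prepend [i] ω)) / N)) Finset.univ
        fun i _ => (hlim (prepend [i] ω)).const_mul _) ?_
    have herr : Tendsto (fun N : ℕ =>
        (transferIterate M φ P N ω - transferIterate M φ P 0 ω) / N) U (𝓝 0) := by
      refine Tendsto.mono_left ?_ hU
      refine squeeze_zero_norm (a := fun N : ℕ => K / N) (fun N => ?_)
        (tendsto_const_div_atTop_nhds_zero_nat K)
      rw [Real.norm_eq_abs, abs_div, Nat.abs_cast]
      refine div_le_div_of_nonneg_right (abs_sub_le_iff.2 ⟨?_, ?_⟩) N.cast_nonneg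
      · linarith [H.transferIterate_le N ω, transferIterate_nonneg M φ P 0 ω]
      · linarith [H.transferIterate_le 0 ω, transferIterate_nonneg M φ P N ω]
    have := (hlim ω).add herr
    rw [add_zero] at this
    refine this.congr fun N => ?_
    rw [← add_div]
    simp only [mul_div_assoc', ← Finset.sum_div, Finset.mul_sum]
    congr 1
    rw [Finset.sum_comm]
    simp only [transferIterate_succ]
    have h1 := Finset.sum_range_succ (fun k => transferIterate M φ P k ω) N
    have h2 := Finset.sum_range_succ' (fun k => transferIterate M φ P k ω) N
    linarith
  · refine le_of_tendsto_of_tendsto' (hlim _) ((hlim _).const_mul _) fun N => ?_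
    rw [mul_div_assoc', Finset.mul_sum]
    refine div_le_div_of_nonneg_right ?_ N.cast_nonneg
    exact Finset.sum_le_sum fun k _ => H.transferIterate_le_exp_mul k hb hξ'

end IsGibbsMass

namespace IsGibbsMass

variable {A : Type*} [Fintype A] {M : A → A → Prop} {φ : (ℕ → A) → ℝ} {P ρ L K : ℝ}
  {m : List A → ℝ}

/-- There is a `g`-function for the cylinder masses, with Lipschitz logarithm. -/
theorem exists_gFunction (H : IsGibbsMass M φ P ρ L K m) :
    ∃ g : A → (ℕ → A) → ℝ, ∃ C > 0, (∀ i ω, 0 ≤ g i ω) ∧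
      (∀ b : List A, b ≠ [] → ∀ i ξ ξ', prepend b ξ ∈ SFT M → prepend b ξ' ∈ SFT M →
        g i (prepend b ξ) ≤ Real.exp (C * ρ ^ b.length) * g i (prepend b ξ')) ∧
      ∀ ω ∈ SFT M, Tendsto (fun N => wordSum N fun x =>
        ∑ i, |m (i :: x ++ [ω 0]) - g i (prepend x ω) * m (x ++ [ω 0])|) atTop (𝓝 0) := by
  obtain ⟨h, c, hc, hz, hlow, heig, hlip⟩ := H.exists_eigenfunction
  have h0 : ∀ ω, 0 ≤ h ω := fun ω => by
    by_cases hω : ω ∈ SFT M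
    · exact hc.le.trans (hlow ω hω)
    · exact (hz ω hω).ge
  have h1ρ : 0 < 1 - ρ := by linarith [H.ρ_mem.2]
  have hρ0 := H.ρ_mem.1
  have hL := H.L_pos
  set C := L / (1 - ρ) with hC
  have hC0 : 0 < C := by positivity
  refine ⟨fun i ω => Real.exp (φ (prepend [i] ω) - P) * h (prepend [i] ω) / h ω, L + 2 * C,
    by positivity, fun i ω => div_nonneg (mul_nonneg (Real.exp_pos _).le (h0 _)) (h0 _), ?_, ?_⟩
  · intro b hb i ξ ξ' hξ hξ'
    have hp : 0 < h (prepend b ξ) := hc.trans_le (hlow _ hξ)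
    have hp' : 0 < h (prepend b ξ') := hc.trans_le (hlow _ hξ')
    by_cases hi : prepend [i] (prepend b ξ) ∈ SFT M
    · have hi' := prepend_mem_SFT_of_head_eq hi hξ' (prepend_head_eq hb ξ ξ')
      rw [← prepend_append] at hi hi'
      have e1 := H.holder _ _ _ hi hi'
      have e2 := hlip _ (by simp) ξ _ hi'
      have e3 := hlip b hb ξ' _ hξ
      have hpow : ρ ^ ([i] ++ b).length ≤ ρ ^ b.length :=
        pow_le_pow_of_le_one hρ0.le H.ρ_mem.2.le (by simp)
      have e4 : Real.exp (φ (prepend ([i] ++ b) ξ) - P) ≤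
          Real.exp (L * ρ ^ b.length) * Real.exp (φ (prepend ([i] ++ b) ξ') - P) := by
        rw [← Real.exp_add, Real.exp_le_exp]
        nlinarith [mul_le_mul_of_nonneg_left hpow hL.le]
      have e5 : h (prepend ([i] ++ b) ξ) ≤
          Real.exp (C * ρ ^ b.length) * h (prepend ([i] ++ b) ξ') :=
        e2.trans (mul_le_mul_of_nonneg_right
          (Real.exp_le_exp.2 (mul_le_mul_of_nonneg_left hpow hC0.le)) (h0 _))
      have e6 : Real.exp ((L + 2 * C) * ρ ^ b.length) = Real.exp (L * ρ ^ b.length) *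
          Real.exp (C * ρ ^ b.length) * Real.exp (C * ρ ^ b.length) := by
        rw [← Real.exp_add, ← Real.exp_add]; congr 1; ring
      simp only [← prepend_append]
      rw [e6, mul_div_assoc', div_le_div_iff₀ hp hp']
      calc _ ≤ (Real.exp (L * ρ ^ b.length) * Real.exp (φ (prepend ([i] ++ b) ξ') - P)) *
            (Real.exp (C * ρ ^ b.length) * h (prepend ([i] ++ b) ξ')) *
            (Real.exp (C * ρ ^ b.length) * h (prepend b ξ)) := by
            refine mul_le_mul (mul_le_mul e4 e5 (h0 _) (by positivity)) e3 hp'.le ?_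
            exact mul_nonneg (by positivity) (mul_nonneg (Real.exp_pos _).le (h0 _))
        _ = _ := by ring
    · simp only [hz _ hi, mul_zero, zero_div]
      exact mul_nonneg (Real.exp_pos _).le
        (div_nonneg (mul_nonneg (Real.exp_pos _).le (h0 _)) (h0 _))
  · intro ω hω
    set q : List A → ℝ := fun x => gibbsWeight φ P x ω * h (prepend x ω) with hq
    have hq0 : ∀ x, 0 ≤ q x := fun x => mul_nonneg (gibbsWeight_pos _ _ _ _).le (h0 _)
    have hmq : ∀ x, m (x ++ [ω 0]) ≤ K / c * q x := by
      intro x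
      by_cases hx : prepend x ω ∈ SFT M
      · calc m (x ++ [ω 0]) ≤ m x := H.concat_le x _
          _ ≤ K * gibbsWeight φ P x ω := H.upper x ω hx
          _ = K / c * (gibbsWeight φ P x ω * c) := by field_simp
          _ ≤ K / c * q x := by
            refine mul_le_mul_of_nonneg_left ?_ (div_nonneg H.K_pos.le hc.le)
            exact mul_le_mul_of_nonneg_left (hlow _ hx) (gibbsWeight_pos _ _ _ _).le
      · rw [H.concat_eq_zero hω hx]
        exact mul_nonneg (div_nonneg H.K_pos.le hc.le) (hq0 x)
    have hqi : ∀ i x, q (i :: x) = Real.exp (φ (prepend [i] (prepend x ω)) - P) *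
        h (prepend [i] (prepend x ω)) * gibbsWeight φ P x ω := by
      intro i x
      simp only [hq, gibbsWeight, prepend_cons i x]
      ring
    have hqs : ∀ x, ∑ i, q (i :: x) = q x := by
      intro x
      simp only [hqi, ← Finset.sum_mul, heig]
      rw [mul_comm]
    have := tendsto_wordSum_abs_sub (m := fun x => m (x ++ [ω 0])) (fun x => H.nonneg _) hq0
      (div_nonneg H.K_pos.le hc.le) hmq (fun x => H.sum_cons _) hqs
    refine this.congr fun N => ?_
    congr 1
    funext x
    refine Finset.sum_congr rfl fun i _ => ?_
    have hw := (gibbsWeight_pos φ P x ω).ne'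
    rw [hqi]
    simp only [hq]
    rw [mul_comm (gibbsWeight φ P x ω), mul_div_mul_right _ _ hw]

/-- Prepending a letter to a nonempty word `b` multiplies its mass by the value of the
`g`-function at any point of `[b]`, up to a factor `exp (± C ρ ^ |b|)`. -/
theorem gFunction_bounds (H : IsGibbsMass M φ P ρ L K m) {g : A → (ℕ → A) → ℝ} {C : ℝ}
    (hg0 : ∀ i ω, 0 ≤ g i ω)
    (hlip : ∀ b : List A, b ≠ [] → ∀ i ξ ξ', prepend b ξ ∈ SFT M → prepend b ξ' ∈ SFT M →
        g i (prepend b ξ) ≤ Real.exp (C * ρ ^ b.length) * g i (prepend b ξ'))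
    (hlim : ∀ ω ∈ SFT M, Tendsto (fun N => wordSum N fun x =>
        ∑ i, |m (i :: x ++ [ω 0]) - g i (prepend x ω) * m (x ++ [ω 0])|) atTop (𝓝 0))
    {b : List A} (hb : b ≠ []) (i : A) {ξ : ℕ → A} (hξ : prepend b ξ ∈ SFT M) :
    m (i :: b) ≤ Real.exp (C * ρ ^ b.length) * (g i (prepend b ξ) * m b) ∧
      g i (prepend b ξ) * m b ≤ Real.exp (C * ρ ^ b.length) * m (i :: b) := by
  set δ := Real.exp (C * ρ ^ b.length) with hδ
  have hδ0 : 0 < δ := Real.exp_pos _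
  set G := g i (prepend b ξ) with hG
  have hG0 : 0 ≤ G := hg0 _ _
  have main : ∀ s : A, ∃ ε : ℕ → ℝ, Tendsto ε atTop (𝓝 0) ∧ ∀ N,
      (wordSum N fun y => m (i :: b ++ (y ++ [s]))) ≤
        (δ * G) * (wordSum N fun y => m (b ++ (y ++ [s]))) + ε N ∧
      G * (wordSum N fun y => m (b ++ (y ++ [s]))) ≤
        δ * (wordSum N fun y => m (i :: b ++ (y ++ [s]))) + δ * ε N := by
    intro s
    by_cases hs : ∃ ω ∈ SFT M, ω 0 = s
    · obtain ⟨ω, hω, rfl⟩ := hs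
      refine ⟨_, (tendsto_add_atTop_iff_nat b.length).2 (hlim ω hω), fun N => ?_⟩
      set e : List A → ℝ := fun x =>
        ∑ i, |m (i :: x ++ [ω 0]) - g i (prepend x ω) * m (x ++ [ω 0])| with he
      have he1 : ∀ y, |m (i :: b ++ (y ++ [ω 0])) -
          g i (prepend b (prepend y ω)) * m (b ++ (y ++ [ω 0]))| ≤ e (b ++ y) := by
        intro y
        have := Finset.single_le_sum (f := fun i => |m (i :: (b ++ y) ++ [ω 0]) -
          g i (prepend (b ++ y) ω) * m ((b ++ y) ++ [ω 0])|) (fun _ _ => abs_nonneg _)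
          (Finset.mem_univ i)
        simpa [he, prepend_append, List.append_assoc] using this
      have he2 := wordSum_append_le N b (f := e)
        (fun x => Finset.sum_nonneg fun _ _ => abs_nonneg _)
      have hm1 : ∀ y, g i (prepend b (prepend y ω)) * m (b ++ (y ++ [ω 0])) ≤
            (δ * G) * m (b ++ (y ++ [ω 0])) ∧
          G * m (b ++ (y ++ [ω 0])) ≤
            δ * (g i (prepend b (prepend y ω)) * m (b ++ (y ++ [ω 0]))) := by
        intro y
        by_cases hy : prepend b (prepend y ω) ∈ SFT M
        · refine ⟨mul_le_mul_of_nonneg_right (hlip b hb i _ _ hy hξ) (H.nonneg _), ?_⟩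
          rw [← mul_assoc]
          exact mul_le_mul_of_nonneg_right (hlip b hb i _ _ hξ hy) (H.nonneg _)
        · rw [← prepend_append] at hy
          have := H.concat_eq_zero hω hy
          rw [List.append_assoc] at this
          simp [this]
      constructor
      · rw [← wordSum_mul_left]
        refine le_trans ?_ (add_le_add_right he2 _)
        rw [← wordSum_add]
        exact wordSum_mono _ fun y => by linarith [abs_le.1 (he1 y), (hm1 y).1]
      · rw [← mul_add, ← wordSum_mul_left]
        refine le_trans ?_ (mul_le_mul_of_nonneg_left (add_le_add_right he2 _) hδ0.le)
        rw [← wordSum_add, ← wordSum_mul_left]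
        refine wordSum_mono _ fun y => (hm1 y).2.trans ?_
        exact mul_le_mul_of_nonneg_left (by linarith [(abs_le.1 (he1 y)).1]) hδ0.le
    · have hz : ∀ w, m (w ++ [s]) = 0 := fun w => H.eq_zero fun ω hω => hs
        ⟨prepend [s] ω, mem_SFT_of_prepend_mem (by rwa [prepend_append] at hω),
          prepend_cons_zero _ _ _⟩
      have hz' : ∀ w y, m (w ++ (y ++ [s])) = 0 := fun w y => by rw [← List.append_assoc, hz]
      refine ⟨fun _ => 0, tendsto_const_nhds, fun N => ?_⟩
      simp only [hz', wordSum, Finset.sum_const_zero, mul_zero, add_zero, le_refl, and_self]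
  choose ε hε hbd using main
  have hE : Tendsto (fun N => ∑ s, ε s N) atTop (𝓝 0) := by
    simpa using tendsto_finsetSum Finset.univ fun s _ => hε s
  have hsum : ∀ (w : List A) N, ∑ s, (wordSum N fun y => m (w ++ (y ++ [s]))) = m w := by
    intro w N
    rw [← wordSum_sum, ← wordSum_succ_concat N (fun y => m (w ++ y)),
      wordSum_concat_eq H.sum_concat]
  constructor
  · have h1 : ∀ N, m (i :: b) ≤ δ * G * m b + ∑ s, ε s N := fun N => by
      rw [← hsum (i :: b) N, ← hsum b N, Finset.mul_sum, ← Finset.sum_add_distrib]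
      exact Finset.sum_le_sum fun s _ => (hbd s N).1
    have h2 := ge_of_tendsto' (hE.const_add (δ * G * m b)) h1
    rw [← mul_assoc]
    simpa using h2
  · have h1 : ∀ N, G * m b ≤ δ * m (i :: b) + δ * ∑ s, ε s N := fun N => by
      rw [← hsum (i :: b) N, ← hsum b N, Finset.mul_sum, Finset.mul_sum, Finset.mul_sum,
        ← Finset.sum_add_distrib]
      exact Finset.sum_le_sum fun s _ => (hbd s N).2
    have h2 := ge_of_tendsto' ((hE.const_mul δ).const_add (δ * m (i :: b))) h1
    simpa using h2

/-- Prepending a word `a` to a nonempty word `b` multiplies its mass by a factor depending only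
on `a` and an arbitrary point of `[b]`, up to an error `exp (± C ρ ^ |b|)`. -/
theorem exists_factor (H : IsGibbsMass M φ P ρ L K m) :
    ∃ C > 0, ∃ Q : List A → (ℕ → A) → ℝ, (∀ a η, 0 ≤ Q a η) ∧ ∀ a b : List A, b ≠ [] → ∀ ξ,
      prepend a (prepend b ξ) ∈ SFT M →
        m (a ++ b) ≤ Real.exp (C * ρ ^ b.length) * (Q a (prepend b ξ) * m b) ∧
        Q a (prepend b ξ) * m b ≤ Real.exp (C * ρ ^ b.length) * m (a ++ b) := by
  obtain ⟨g, C, hC, hg0, hlip, hlim⟩ := H.exists_gFunction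
  have h1ρ : 0 < 1 - ρ := by linarith [H.ρ_mem.2]
  have hρ0 := H.ρ_mem.1
  let Q : List A → (ℕ → A) → ℝ := fun a η =>
    List.rec 1 (fun i a q => g i (prepend a η) * q) a
  have hQ0 : ∀ a η, 0 ≤ Q a η := by
    intro a η
    induction a with
    | nil => exact zero_le_one
    | cons i a ih => exact mul_nonneg (hg0 _ _) ih
  refine ⟨C / (1 - ρ), by positivity, Q, hQ0, fun a b hb ξ => ?_⟩
  suffices hs : prepend a (prepend b ξ) ∈ SFT M →
      m (a ++ b) ≤ Real.exp (C / (1 - ρ) * ρ ^ b.length * (1 - ρ ^ a.length)) *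
        (Q a (prepend b ξ) * m b) ∧
      Q a (prepend b ξ) * m b ≤
        Real.exp (C / (1 - ρ) * ρ ^ b.length * (1 - ρ ^ a.length)) * m (a ++ b) by
    intro h
    have hle : Real.exp (C / (1 - ρ) * ρ ^ b.length * (1 - ρ ^ a.length)) ≤
        Real.exp (C / (1 - ρ) * ρ ^ b.length) := by
      refine Real.exp_le_exp.2 ?_
      have h1 : 0 ≤ C / (1 - ρ) * ρ ^ b.length := by positivity
      have h2 : 0 ≤ ρ ^ a.length := by positivity
      nlinarith
    exact ⟨(hs h).1.trans (mul_le_mul_of_nonneg_right hle (mul_nonneg (hQ0 _ _) (H.nonneg _))),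
      (hs h).2.trans (mul_le_mul_of_nonneg_right hle (H.nonneg _))⟩
  induction a with
  | nil => simp [Q]
  | cons i a ih =>
    intro h
    have ha := (prepend_cons_mem_SFT.1 h).2
    obtain ⟨i1, i2⟩ := ih ha
    rw [← prepend_append] at ha
    obtain ⟨g1, g2⟩ := H.gFunction_bounds hg0 hlip hlim (b := a ++ b) (by simp [hb]) i ha
    rw [prepend_append] at g1 g2
    have hexp : Real.exp (C / (1 - ρ) * ρ ^ b.length * (1 - ρ ^ (i :: a).length)) =
        Real.exp (C * ρ ^ (a ++ b).length) *
          Real.exp (C / (1 - ρ) * ρ ^ b.length * (1 - ρ ^ a.length)) := by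
      rw [← Real.exp_add, List.length_cons, List.length_append, pow_succ, pow_add]
      congr 1
      field_simp
      ring
    have hQ : Q (i :: a) (prepend b ξ) = g i (prepend a (prepend b ξ)) * Q a (prepend b ξ) := rfl
    have hG := hg0 i (prepend a (prepend b ξ))
    rw [hexp, hQ, List.cons_append]
    constructor
    · calc _ ≤ _ := g1
        _ ≤ _ := mul_le_mul_of_nonneg_left (mul_le_mul_of_nonneg_left i1 hG) (Real.exp_pos _).le
        _ = _ := by ring
    · calc _ = g i (prepend a (prepend b ξ)) * (Q a (prepend b ξ) * m b) := by ring
        _ ≤ _ := mul_le_mul_of_nonneg_left i2 hG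
        _ = Real.exp (C / (1 - ρ) * ρ ^ b.length * (1 - ρ ^ a.length)) *
            (g i (prepend a (prepend b ξ)) * m (a ++ b)) := by ring
        _ ≤ _ := mul_le_mul_of_nonneg_left g2 (Real.exp_pos _).le
        _ = _ := by ring

theorem exists_cross_ratio_bound (H : IsGibbsMass M φ P ρ L K m) :
    ∃ C > 0, ∀ a a' b c : List A, b ≠ [] → (∃ ξ, prepend (a ++ b ++ c) ξ ∈ SFT M) →
      (∃ ξ, prepend (a' ++ b ++ c) ξ ∈ SFT M) →
      m (a ++ b ++ c) * m (a' ++ b) ≤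
        Real.exp (C * ρ ^ b.length) * (m (a ++ b) * m (a' ++ b ++ c)) := by
  obtain ⟨C, hC, Q, hQ0, hQ⟩ := H.exists_factor
  have hρ0 := H.ρ_mem.1
  refine ⟨4 * C, by positivity, fun a a' b c hb ⟨ξ, hξ⟩ ⟨ξ', hξ'⟩ => ?_⟩
  rw [List.append_assoc] at hξ hξ' ⊢
  rw [List.append_assoc]
  rw [prepend_append] at hξ hξ'
  have hη : prepend (b ++ c) ξ ∈ SFT M := mem_SFT_of_prepend_mem hξ
  have ha' : prepend a' (prepend (b ++ c) ξ) ∈ SFT M :=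
    prepend_mem_SFT_of_head_eq hξ' hη (prepend_head_eq (by simp [hb]) _ _)
  have hbc : b ++ c ≠ [] := by simp [hb]
  set η := prepend (b ++ c) ξ with hηd
  have hη' : prepend b (prepend c ξ) = η := (prepend_append b c ξ).symm
  set δ := Real.exp (C * ρ ^ b.length) with hδ
  have hδ0 : 0 < δ := Real.exp_pos _
  have hle : Real.exp (C * ρ ^ (b ++ c).length) ≤ δ :=
    Real.exp_le_exp.2 (mul_le_mul_of_nonneg_left
      (pow_le_pow_of_le_one hρ0.le H.ρ_mem.2.le (by simp)) hC.le)
  have e1 := (hQ a (b ++ c) hbc ξ hξ).1.trans (mul_le_mul_of_nonneg_right hle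
    (mul_nonneg (hQ0 _ _) (H.nonneg _)))
  have e2 := (hQ a' (b ++ c) hbc ξ ha').2.trans (mul_le_mul_of_nonneg_right hle (H.nonneg _))
  have e3 := (hQ a' b hb (prepend c ξ) (by rwa [hη'])).1
  have e4 := (hQ a b hb (prepend c ξ) (by rwa [hη'])).2
  rw [← hηd] at e1 e2
  rw [hη'] at e3 e4
  have hexp : Real.exp (4 * C * ρ ^ b.length) = δ * δ * (δ * δ) := by
    rw [hδ, ← Real.exp_add, ← Real.exp_add]; congr 1; ring
  rw [hexp]
  calc _ ≤ (δ * (Q a η * m (b ++ c))) * (δ * (Q a' η * m b)) :=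
        mul_le_mul e1 e3 (H.nonneg _)
          (mul_nonneg hδ0.le (mul_nonneg (hQ0 _ _) (H.nonneg _)))
    _ = δ * δ * ((Q a η * m b) * (Q a' η * m (b ++ c))) := by ring
    _ ≤ δ * δ * ((δ * m (a ++ b)) * (δ * m (a' ++ (b ++ c)))) := by
        refine mul_le_mul_of_nonneg_left ?_ (by positivity)
        exact mul_le_mul e4 e2 (mul_nonneg (hQ0 _ _) (H.nonneg _))
          (mul_nonneg hδ0.le (H.nonneg _))
    _ = _ := by ring

/-- Quasi-Bernoulli bounds. -/
lemma append_bounds (H : IsGibbsMass M φ P ρ L K m) {a c : List A} {ω : ℕ → A}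
    (h : prepend (a ++ c) ω ∈ SFT M) :
    m (a ++ c) ≤ K ^ 3 * (m a * m c) ∧ m a * m c ≤ K ^ 3 * m (a ++ c) := by
  have hK := H.K_pos
  have h' := h
  rw [prepend_append] at h'
  have hc := mem_SFT_of_prepend_mem h'
  have u := H.upper _ _ h
  have l := H.lower _ _ h
  have ua := H.upper _ _ h'
  have la := H.lower _ _ h'
  have uc := H.upper _ _ hc
  have lc := H.lower _ _ hc
  rw [gibbsWeight_append] at u l
  rw [inv_mul_le_iff₀ hK] at l la lc
  have pa := gibbsWeight_pos φ P a (prepend c ω)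
  have pc := gibbsWeight_pos φ P c ω
  constructor
  · calc _ ≤ _ := u
      _ ≤ K * ((K * m a) * (K * m c)) :=
        mul_le_mul_of_nonneg_left (mul_le_mul la lc pc.le (by linarith)) hK.le
      _ = _ := by ring
  · calc _ ≤ (K * gibbsWeight φ P a (prepend c ω)) * (K * gibbsWeight φ P c ω) :=
        mul_le_mul ua uc (H.nonneg _) (by positivity)
      _ = K ^ 2 * (gibbsWeight φ P a (prepend c ω) * gibbsWeight φ P c ω) := by ring
      _ ≤ K ^ 2 * (K * m (a ++ c)) := mul_le_mul_of_nonneg_left l (by positivity)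
      _ = _ := by ring

theorem exists_abs_cross_ratio_sub_one_lt (H : IsGibbsMass M φ P ρ L K m) :
    ∃ C > 0, ∀ a a' b c : List A, (∃ ξ, prepend (a ++ b ++ c) ξ ∈ SFT M) →
      (∃ ξ, prepend (a' ++ b ++ c) ξ ∈ SFT M) →
      |m (a ++ b ++ c) * m (a' ++ b) / (m (a ++ b) * m (a' ++ b ++ c)) - 1| <
        C * ρ ^ b.length := by
  obtain ⟨C, hC, hR⟩ := H.exists_cross_ratio_bound
  have hρ0 := H.ρ_mem.1
  have hK := H.K_pos
  refine ⟨C * Real.exp C + K ^ 6 + 2, by positivity, fun a a' b c h h' => ?_⟩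
  have pos : ∀ a, (∃ ξ, prepend (a ++ b ++ c) ξ ∈ SFT M) →
      0 < m (a ++ b) ∧ 0 < m (a ++ b ++ c) := by
    rintro a ⟨ξ, hξ⟩
    exact ⟨H.pos (ω := prepend c ξ) (by rwa [← prepend_append]), H.pos hξ⟩
  obtain ⟨p1, p2⟩ := pos a h
  obtain ⟨p3, p4⟩ := pos a' h'
  have pd : 0 < m (a ++ b) * m (a' ++ b ++ c) := mul_pos p1 p4
  set R := m (a ++ b ++ c) * m (a' ++ b) / (m (a ++ b) * m (a' ++ b ++ c)) with hRd
  have hR0 : 0 < R := div_pos (mul_pos p2 p3) pd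
  rcases eq_or_ne b [] with rfl | hb
  · have hR6 : R ≤ K ^ 6 := by
      rw [hRd, div_le_iff₀ pd]
      simp only [List.append_nil] at h h' p1 p2 p3 p4 ⊢
      obtain ⟨ξ, hξ⟩ := h
      obtain ⟨ξ', hξ'⟩ := h'
      calc _ ≤ K ^ 3 * (m a * m c) * m a' :=
            mul_le_mul_of_nonneg_right (H.append_bounds hξ).1 p3.le
        _ = K ^ 3 * m a * (m a' * m c) := by ring
        _ ≤ K ^ 3 * m a * (K ^ 3 * m (a' ++ c)) :=
            mul_le_mul_of_nonneg_left (H.append_bounds hξ').2 (by positivity)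
        _ = _ := by ring
    have : 0 < C * Real.exp C := by positivity
    rw [List.length_nil, pow_zero, mul_one, abs_lt]
    constructor <;> linarith
  · set t := C * ρ ^ b.length with ht
    have hpow : 0 < ρ ^ b.length := by positivity
    have ht0 : 0 < t := by positivity
    have htC : t ≤ C := mul_le_of_le_one_right hC.le (pow_le_one₀ hρ0.le H.ρ_mem.2.le)
    have hR1 : R ≤ Real.exp t := (div_le_iff₀ pd).2 (hR a a' b c hb h h')
    have hR2 : 1 ≤ Real.exp t * R := by
      rw [hRd, mul_div_assoc', le_div_iff₀ pd, one_mul]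
      have := hR a' a b c hb h' h
      linarith
    have e1 : 1 - t ≤ Real.exp (-t) := by linarith [Real.add_one_le_exp (-t)]
    have e2 : Real.exp t - 1 ≤ t * Real.exp t := by
      have : Real.exp (-t) * Real.exp t = 1 := by rw [← Real.exp_add]; simp
      nlinarith [Real.exp_pos t]
    have e3 : t * Real.exp t ≤ C * Real.exp C * ρ ^ b.length := by
      calc _ ≤ t * Real.exp C := mul_le_mul_of_nonneg_left (Real.exp_le_exp.2 htC) ht0.le
        _ = _ := by rw [ht]; ring
    have e4 : C * Real.exp C * ρ ^ b.length <
        (C * Real.exp C + K ^ 6 + 2) * ρ ^ b.length :=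
      mul_lt_mul_of_pos_right (by linarith [pow_pos hK 6]) hpow
    have e5 : 1 - R ≤ Real.exp t - 1 := by
      have : 1 ≤ Real.exp t := Real.one_le_exp ht0.le
      nlinarith
    rw [abs_lt]
    constructor <;> linarith

end IsGibbsMass

theorem stmt8 {A : Type*} [Fintype A] [MeasurableSpace A] [DiscreteMeasurableSpace A]
    (M : A → A → Prop) (Y : Set (ℕ → A)) (hY : Y = SFT M)
    (htrans : IrreducibleTransition M)
    (ρ : ℝ) (hρ : ρ ∈ Set.Ioo (0 : ℝ) 1)
    (φ : (ℕ → A) → ℝ) (hHolder : IsHolder Y φ ρ)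
    (μ : Measure (ℕ → A)) [IsProbabilityMeasure μ]
    (hinv : μ.map shiftN = μ) (hsupp : μ Y = 1)
    (P : ℝ) (hGibbs : HasGibbsProperty Y μ φ P) :
    ∃ K > 0, ∀ a a' b c : List A,
      (cylinder (a ++ b ++ c) ∩ Y).Nonempty → (cylinder (a' ++ b ++ c) ∩ Y).Nonempty →
      |(μ (cylinder (a ++ b ++ c))).toReal * (μ (cylinder (a' ++ b))).toReal /
          ((μ (cylinder (a ++ b))).toReal * (μ (cylinder (a' ++ b ++ c))).toReal) - 1| <
        K * ρ ^ b.length := by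
  subst hY
  obtain ⟨L, hL, hφ⟩ := hHolder
  obtain ⟨K, hK, hG⟩ := hGibbs
  have H : IsGibbsMass M φ P ρ L K fun w => μ.real (cylinder w) :=
    { ρ_mem := hρ
      L_pos := hL
      K_pos := hK
      holder := fun w ξ ξ' h h' => by
        have := hφ _ h _ h' w.length fun i hi => prepend_eq_of_lt w ξ ξ' hi
        linarith [(abs_le.1 this).2]
      nonneg := fun w => measureReal_nonneg
      nil := by simp [_root_.cylinder]
      sum_cons := sum_measureReal_cylinder_cons μ hinv
      sum_concat := sum_measureReal_cylinder_concat μ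
      exists_mem := fun w => exists_prepend_mem_of_measureReal_pos μ hsupp
      lower := fun w ω h => by rw [gibbsWeight_eq]; exact (hG w ω h).1
      upper := fun w ω h => by rw [gibbsWeight_eq]; exact (hG w ω h).2 }
  obtain ⟨C, hC, h⟩ := H.exists_abs_cross_ratio_sub_one_lt
  exact ⟨C, hC, fun a a' b c h1 h2 => h a a' b c
    ((cylinder_inter_nonempty_iff _ _).1 h1) ((cylinder_inter_nonempty_iff _ _).1 h2)⟩
end
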